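/- Let r ≥ 2, q a positive integer, λ an integer, V ≥ 1, and define K_{r,q}(λ, V) as the number of (v_1, …, v_{2r}) with |v_i| ≤ V, λ+v_i invertible mod q, and Σ_{i=1}^r (λ+v_i)^{−1} ≡ Σ_{i=r+1}^{2r} (λ+v_i)^{−1} (mod q). Then for every ε > 0, K_{r,q}(λ, V) ≤ C(r, ε)·(V^{2r}/q^{1/(4(r−1))} + V^r)·q^ε. -/

import Mathlib

open scoped Classical in
/-- `K_{r,q}(λ, V)`: the number of tuples `(v_1, …, v_{2r})` with `|v_i| ≤ V`,
each `λ + v_i` invertible mod `q`, and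
`Σ_{i=1}^r (λ+v_i)⁻¹ ≡ Σ_{i=r+1}^{2r} (λ+v_i)⁻¹ (mod q)`. -/
noncomputable def Kcount (r q : ℕ) (lam : ℤ) (V : ℕ) : ℕ :=
  ((Fintype.piFinset (fun _ : Fin (r + r) => Finset.Icc (-(V : ℤ)) (V : ℤ))).filter
    (fun v : Fin (r + r) → ℤ =>
      (∀ i, IsUnit ((lam + v i : ℤ) : ZMod q)) ∧
      ∑ i : Fin r, (((lam + v (Fin.castAdd r i) : ℤ) : ZMod q))⁻¹ =
        ∑ i : Fin r, (((lam + v (Fin.natAdd r i) : ℤ) : ZMod q))⁻¹)).card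


lemma kg_smooth_count (δ : ℝ) (hδ : 0 < δ) : ∃ C : ℝ, 1 ≤ C ∧ ∀ D X : ℕ, D ≠ 0 → 1 ≤ X →
    ((((Finset.Icc 1 X).filter (fun a => a.primeFactors ⊆ D.primeFactors)).card : ℕ) : ℝ)
      ≤ C * ((X : ℝ) * (D : ℝ)) ^ δ := by
  -- constants
  set K : ℝ := (1 - (2 : ℝ) ^ (-δ))⁻¹ with hK
  have h2 : (2 : ℝ) ^ (-δ) < 1 := Real.rpow_lt_one_of_one_lt_of_neg (by norm_num) (by linarith)
  have h2' : 0 < (2 : ℝ) ^ (-δ) := by positivity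
  have hK1 : 1 ≤ K := by
    rw [hK]; exact (one_le_inv₀ (by linarith)).2 (by linarith)
  set N : ℕ := ⌈(2 : ℝ) ^ (1 / δ)⌉₊ with hN
  refine ⟨K ^ N, one_le_pow₀ hK1, ?_⟩
  intro D X hD hX
  let f : ℕ →* ℝ :=
    { toFun := fun n => (n : ℝ) ^ (-δ)
      map_one' := by simp
      map_mul' := by
        intro a b
        push_cast
        exact Real.mul_rpow (by positivity) (by positivity) }
  have hf : ∀ n : ℕ, f n = (n : ℝ) ^ (-δ) := fun n => rfl
  have hfp : ∀ {p : ℕ}, p.Prime → ‖f p‖ < 1 := by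
    intro p hp
    rw [hf, Real.norm_of_nonneg (by positivity)]
    exact Real.rpow_lt_one_of_one_lt_of_neg (by exact_mod_cast hp.one_lt) (by linarith)
  obtain ⟨hs1, hs2⟩ :=
    EulerProduct.summable_and_hasSum_factoredNumbers_prod_filter_prime_geometric (f := f) hfp
      D.primeFactors
  set S := (Finset.Icc 1 X).filter (fun a => a.primeFactors ⊆ D.primeFactors) with hS
  have hmem : ∀ a ∈ S, a ∈ Nat.factoredNumbers D.primeFactors := by
    intro a ha
    rw [hS, Finset.mem_filter, Finset.mem_Icc] at ha
    exact Nat.mem_factoredNumbers_of_primeFactors_subset (by omega) ha.2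
  have hsum : ∑ a ∈ S, (a : ℝ) ^ (-δ) ≤ ∏ p ∈ D.primeFactors with p.Prime, (1 - f p)⁻¹ := by
    have := sum_le_hasSum (f := fun m : Nat.factoredNumbers D.primeFactors ↦ f m)
      (S.attach.map ⟨fun a => ⟨a.1, hmem a.1 a.2⟩, fun a b h => by
        apply Subtype.ext; simpa using congrArg Subtype.val h⟩) (fun i _ => by
          rw [hf]; positivity) hs2
    rw [Finset.sum_map] at this
    refine le_trans (le_of_eq ?_) this
    exact (Finset.sum_attach S (fun a => (a : ℝ) ^ (-δ))).symm
  have hprod : ∏ p ∈ D.primeFactors with p.Prime, (1 - f p)⁻¹ ≤ K ^ N * (D : ℝ) ^ δ := by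
    have hfil : D.primeFactors.filter Nat.Prime = D.primeFactors :=
      Finset.filter_true_of_mem (fun p hp => Nat.prime_of_mem_primeFactors hp)
    rw [hfil]
    have hfac : ∀ p ∈ D.primeFactors, (1 - f p)⁻¹ ≤ (if p < N then K else 1) * (p : ℝ) ^ δ := by
      intro p hp
      have hpp := Nat.prime_of_mem_primeFactors hp
      have hp2 : (2 : ℝ) ≤ p := by exact_mod_cast hpp.two_le
      have hp1 : (1 : ℝ) ≤ (p : ℝ) ^ δ := Real.one_le_rpow (by linarith) hδ.le
      rw [hf, Real.rpow_neg (by positivity)]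
      split_ifs with hlt
      · have : ((p : ℝ) ^ δ)⁻¹ ≤ (2 : ℝ) ^ (-δ) := by
          rw [Real.rpow_neg (by norm_num)]
          gcongr
        calc (1 - ((p : ℝ) ^ δ)⁻¹)⁻¹ ≤ K := by
              rw [hK]; exact inv_anti₀ (by linarith) (by linarith)
          _ ≤ K * (p : ℝ) ^ δ := le_mul_of_one_le_right (by linarith) hp1
      · have h3 : (2 : ℝ) ≤ (p : ℝ) ^ δ := by
          have h4 : (2 : ℝ) ^ (1 / δ) ≤ p := (Nat.le_ceil _).trans (by exact_mod_cast not_lt.1 hlt)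
          calc (2 : ℝ) = ((2 : ℝ) ^ (1 / δ)) ^ δ := by
                rw [← Real.rpow_mul (by norm_num)]; field_simp; simp
            _ ≤ _ := by gcongr
        have h5 : 0 < (p : ℝ) ^ δ := by linarith
        rw [one_mul, inv_le_comm₀ _ h5]
        · have : ((p : ℝ) ^ δ)⁻¹ ≤ 2⁻¹ := inv_anti₀ (by norm_num) h3
          linarith
        · have : ((p : ℝ) ^ δ)⁻¹ ≤ 2⁻¹ := inv_anti₀ (by norm_num) h3
          norm_num at this ⊢
          linarith
    calc ∏ p ∈ D.primeFactors, (1 - f p)⁻¹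
        ≤ ∏ p ∈ D.primeFactors, ((if p < N then K else 1) * (p : ℝ) ^ δ) := by
          apply Finset.prod_le_prod
          · intro p hp
            have := hfp (Nat.prime_of_mem_primeFactors hp)
            rw [Real.norm_eq_abs, abs_lt] at this
            exact inv_nonneg.2 (by linarith)
          · exact hfac
      _ = (∏ p ∈ D.primeFactors, (if p < N then K else 1)) * ∏ p ∈ D.primeFactors, (p : ℝ) ^ δ :=
          Finset.prod_mul_distrib
      _ ≤ K ^ N * (D : ℝ) ^ δ := by
          gcongr
          · rw [← Finset.prod_filter, Finset.prod_const]
            apply pow_le_pow_right₀ hK1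
            calc _ ≤ (Finset.range N).card := Finset.card_le_card (by
                  intro p hp; rw [Finset.mem_filter] at hp; exact Finset.mem_range.2 hp.2)
              _ = N := Finset.card_range N
          · rw [Real.finsetProd_rpow _ _ (fun i _ => by positivity)]
            gcongr
            have := Nat.le_of_dvd (Nat.pos_of_ne_zero hD) (Nat.prod_primeFactors_dvd D)
            rw [← Nat.cast_prod]
            exact Nat.cast_le.2 this
  have hcard : (S.card : ℝ) * (X : ℝ) ^ (-δ) ≤ ∑ a ∈ S, (a : ℝ) ^ (-δ) := by
    rw [← nsmul_eq_mul, ← Finset.sum_const]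
    apply Finset.sum_le_sum
    intro a ha
    rw [hS, Finset.mem_filter, Finset.mem_Icc] at ha
    have h1 : (0 : ℝ) < a := by exact_mod_cast ha.1.1
    apply Real.rpow_le_rpow_of_nonpos h1 (by exact_mod_cast ha.1.2) (by linarith)
  have hXp : (0 : ℝ) < X := by exact_mod_cast hX
  rw [Real.mul_rpow hXp.le (by positivity)]
  have h6 := hcard.trans (hsum.trans hprod)
  rw [Real.rpow_neg hXp.le, ← div_eq_mul_inv, div_le_iff₀ (by positivity)] at h6
  linarith

lemma kg_divisor_bound (δ : ℝ) (hδ : 0 < δ) : ∃ C : ℝ, 1 ≤ C ∧ ∀ n : ℕ, n ≠ 0 →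
    ((n.divisors.card : ℕ) : ℝ) ≤ C * (n : ℝ) ^ δ := by
  obtain ⟨C, hC, h⟩ := kg_smooth_count (δ / 2) (by linarith)
  refine ⟨C, hC, fun n hn => ?_⟩
  have h1 := h n n hn (Nat.one_le_iff_ne_zero.2 hn)
  have h2 : ((n : ℝ) * n) ^ (δ / 2) = (n : ℝ) ^ δ := by
    rw [Real.mul_rpow (by positivity) (by positivity), ← Real.rpow_add (by positivity)]; ring_nf
  rw [h2] at h1
  refine le_trans ?_ h1
  norm_cast
  apply Finset.card_le_card
  intro a ha
  rw [Nat.mem_divisors] at ha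
  rw [Finset.mem_filter, Finset.mem_Icc]
  exact ⟨⟨Nat.pos_of_dvd_of_pos ha.1 (Nat.pos_of_ne_zero hn),
    Nat.le_of_dvd (Nat.pos_of_ne_zero hn) ha.1⟩, Nat.primeFactors_mono ha.1 hn⟩

lemma kg_coprime_split (D : ℕ) (hD : D ≠ 0) (n : ℕ) (hn : n ≠ 0) : ∃ a b : ℕ, n = a * b ∧
    a.primeFactors ⊆ D.primeFactors ∧ Nat.Coprime b D := by
  induction n using Nat.strong_induction_on with
  | _ n ih =>
    by_cases hc : Nat.Coprime n D
    · exact ⟨1, n, by simp, by simp, hc⟩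
    · obtain ⟨p, hp, hpn, hpD⟩ := Nat.Prime.not_coprime_iff_dvd.1 hc
      obtain ⟨m, rfl⟩ := hpn
      have hm : m ≠ 0 := by rintro rfl; simp at hn
      obtain ⟨a, b, h1, h2, h3⟩ := ih m (by
        have := hp.two_le
        have := Nat.pos_of_ne_zero hm
        nlinarith) hm
      have ha : a ≠ 0 := by rintro rfl; simp at h1; exact hm h1
      refine ⟨p * a, b, by rw [h1, mul_assoc], ?_, h3⟩
      rw [Nat.primeFactors_mul hp.ne_zero ha, hp.primeFactors]
      apply Finset.union_subset _ h2
      simp [hp, hpD, hD]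

open Polynomial in
lemma kg_hensel (f : ℤ[X]) (D : ℕ) (A B : ℤ[X]) (hAB : A * f + B * derivative f = C (D : ℤ))
    (t : ℕ) (ht : Nat.Coprime t D) (x y : ℤ) (hx : (t : ℤ) ∣ f.eval x) (hy : (t : ℤ) ∣ f.eval y)
    (hp : ∀ p : ℕ, p.Prime → p ∣ t → (p : ℤ) ∣ x - y) : (t : ℤ) ∣ x - y := by
  obtain ⟨z, hz⟩ := Polynomial.binomExpansion f y (x - y)
  rw [add_sub_cancel] at hz
  have h1 : (t : ℤ) ∣ (x - y) * ((derivative f).eval y + z * (x - y)) := by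
    have : (x - y) * ((derivative f).eval y + z * (x - y)) = f.eval x - f.eval y := by
      rw [hz]; ring
    rw [this]; exact dvd_sub hx hy
  refine IsCoprime.dvd_of_dvd_mul_right ?_ h1
  rw [Int.isCoprime_iff_gcd_eq_one, Int.gcd_eq_natAbs, Int.natAbs_natCast]
  by_contra hne
  obtain ⟨p, hpp, hpt, hpk⟩ := Nat.Prime.not_coprime_iff_dvd.1 hne
  have h2 := hp p hpp hpt
  have h3 : (p : ℤ) ∣ (derivative f).eval y := by
    have := Int.natCast_dvd.2 hpk
    exact (dvd_add_left (h2.mul_left z)).1 this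
  have h4 : (p : ℤ) ∣ f.eval y := (Int.natCast_dvd_natCast.2 hpt).trans hy
  have h5 : (p : ℤ) ∣ (D : ℤ) := by
    have := congrArg (Polynomial.eval y) hAB
    simp only [eval_add, eval_mul, eval_C] at this
    rw [← this]
    exact dvd_add (h4.mul_left _) (h3.mul_left _)
  have h6 := Nat.dvd_gcd hpt (Int.natCast_dvd_natCast.1 h5)
  rw [Nat.Coprime.gcd_eq_one ht] at h6
  exact hpp.one_lt.ne' (Nat.dvd_one.1 h6)

lemma kg_decomp {m : ℕ} (g : Fin m → ℕ) (t : ℕ) (h : t ∣ ∏ j, g j) :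
    ∃ e : Fin m → ℕ, t = ∏ j, e j ∧ ∀ j, e j ∣ g j := by
  induction m generalizing t with
  | zero => exact ⟨fun _ => 1, by simpa using h, fun j => j.elim0⟩
  | succ m ih =>
    rw [Fin.prod_univ_succ] at h
    obtain ⟨a, b, ha, hb, rfl⟩ := exists_dvd_and_dvd_of_dvd_mul h
    obtain ⟨e, he, he'⟩ := ih (fun j => g j.succ) b hb
    refine ⟨Fin.cons a e, by simp [Fin.prod_univ_succ, he], ?_⟩
    intro j
    refine Fin.cases ?_ ?_ j
    · simpa using ha
    · intro i; simpa using he' i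

lemma kg_sum_rsqrt (N : ℕ) : ∑ m ∈ Finset.Icc 1 N, 1 / √(m : ℝ) ≤ 2 * √(N : ℝ) := by
  induction N with
  | zero => simp
  | succ n ih =>
    rw [Finset.sum_Icc_succ_top (by omega)]
    have h1 : 0 < √((n + 1 : ℕ) : ℝ) := Real.sqrt_pos.2 (by positivity)
    have h2 : √(n : ℝ) ^ 2 = n := Real.sq_sqrt (by positivity)
    have h3 : √((n + 1 : ℕ) : ℝ) ^ 2 = n + 1 := by rw [Real.sq_sqrt (by positivity)]; push_cast; ring
    have h4 : 1 / √((n + 1 : ℕ) : ℝ) ≤ 2 * √((n + 1 : ℕ) : ℝ) - 2 * √(n : ℝ) := by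
      rw [div_le_iff₀ h1]
      nlinarith [sq_nonneg (√((n + 1 : ℕ) : ℝ) - √(n : ℝ))]
    linarith

section
open Polynomial


lemma kg_class_card (V t : ℕ) (ht : 1 ≤ t) (T : Finset ℤ) (hT : ∀ x ∈ T, -(V : ℤ) ≤ x ∧ x ≤ V)
    (hc : ∀ x ∈ T, ∀ y ∈ T, (t : ℤ) ∣ x - y) : (T.card : ℝ) ≤ 2 * V / t + 2 := by
  have ht' : (0 : ℤ) < t := by exact_mod_cast ht
  have htr : (0 : ℝ) < t := by exact_mod_cast ht
  have h1 : T.card ≤ (Finset.Icc ((-(V : ℤ)) / t) ((V : ℤ) / t)).card := by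
    apply Finset.card_le_card_of_injOn (fun x : ℤ => x / (t : ℤ))
    · intro x hx
      have := hT x hx
      simp only [Finset.coe_Icc, Set.mem_Icc]
      exact ⟨Int.ediv_le_ediv ht' this.1, Int.ediv_le_ediv ht' this.2⟩
    · intro x hx y hy hxy
      simp only at hxy
      have h := hc x hx y hy
      have h2 : x % t = y % t := Int.emod_eq_emod_iff_emod_sub_eq_zero.2 (Int.emod_eq_zero_of_dvd h)
      rw [← Int.mul_ediv_add_emod x t, ← Int.mul_ediv_add_emod y t, hxy, h2]
  rw [Int.card_Icc] at h1
  have h3 : ((V : ℤ) / t) * t ≤ V := Int.ediv_mul_le _ ht'.ne'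
  have h4 : -(V : ℤ) < ((-(V : ℤ)) / t + 1) * t := Int.lt_ediv_add_one_mul_self _ ht'
  have h5 : (((V : ℤ) / t : ℤ) : ℝ) * t ≤ V := by exact_mod_cast h3
  have h6 : -(V : ℝ) < ((((-(V : ℤ)) / t : ℤ) : ℝ) + 1) * t := by exact_mod_cast h4
  have h7 : (((V : ℤ) / t : ℤ) : ℝ) ≤ V / t := by rw [le_div_iff₀ htr]; exact h5
  have h8 : -(V : ℝ) / t ≤ (((-(V : ℤ)) / t : ℤ) : ℝ) + 1 := by rw [div_le_iff₀ htr]; exact h6.le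
  have h9 : (((V : ℤ) / t + 1 - (-(V : ℤ)) / t).toNat : ℝ) ≤ 2 * V / t + 2 := by
    have h10 : (-(V : ℤ)) / t ≤ (V : ℤ) / t := Int.ediv_le_ediv ht' (by omega)
    have h11 : (((V : ℤ) / t + 1 - (-(V : ℤ)) / t).toNat : ℤ) = (V : ℤ) / t + 1 - (-(V : ℤ)) / t :=
      Int.toNat_of_nonneg (by omega)
    have h12 : (((V : ℤ) / t + 1 - (-(V : ℤ)) / t).toNat : ℝ) = (((V : ℤ) / t : ℤ) : ℝ) + 1 - (((-(V : ℤ)) / t : ℤ) : ℝ) := by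
      exact_mod_cast h11
    rw [h12]
    have : 2 * (V : ℝ) / t = V / t + V / t := by ring
    have h13 : -(V : ℝ) / t = - (V / t) := by ring
    linarith
  exact (Nat.cast_le.2 h1).trans h9

lemma kg_fiber (f : ℤ[X]) (hf : 0 < f.natDegree) (n : ℕ) (T : Finset ℤ)
    (hT : ∀ x ∈ T, (f.eval x).natAbs = n) : T.card ≤ 2 * f.natDegree := by
  have h1 : (f - C (n : ℤ)) ≠ 0 := by
    intro h; rw [sub_eq_zero] at h; rw [h, natDegree_C] at hf; exact lt_irrefl _ hf
  have h2 : (f + C (n : ℤ)) ≠ 0 := by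
    intro h; rw [← sub_neg_eq_add, ← C_neg, sub_eq_zero] at h
    rw [h, natDegree_C] at hf; exact lt_irrefl _ hf
  have h3 := mul_ne_zero h1 h2
  have hsub : T ⊆ ((f - C (n : ℤ)) * (f + C (n : ℤ))).roots.toFinset := by
    intro x hx
    rw [Multiset.mem_toFinset, mem_roots h3, IsRoot, eval_mul, eval_sub, eval_add, eval_C]
    rcases Int.natAbs_eq_iff.1 (hT x hx) with h | h <;> rw [h] <;> ring
  calc T.card ≤ _ := Finset.card_le_card hsub
    _ ≤ _ := Multiset.toFinset_card_le _
    _ ≤ _ := card_roots' _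
    _ ≤ (f - C (n : ℤ)).natDegree + (f + C (n : ℤ)).natDegree := natDegree_mul_le
    _ = _ := by rw [natDegree_sub_C, natDegree_add_C]; ring

lemma kg_class_sum (f : ℤ[X]) (hf : 0 < f.natDegree) (D V Q t : ℕ) (hV : 1 ≤ V) (ht : 1 ≤ t)
    (a b : ℤ → ℕ) (T : Finset ℤ) (hT : ∀ x ∈ T, -(V : ℤ) ≤ x ∧ x ≤ V)
    (hQ : ∀ x ∈ T, (f.eval x).natAbs ≤ Q) (h0 : ∀ x ∈ T, f.eval x ≠ 0)
    (hab : ∀ x ∈ T, (f.eval x).natAbs = a x * b x)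
    (ha : ∀ x ∈ T, (a x).primeFactors ⊆ D.primeFactors)
    (hb : ∀ x ∈ T, t ∣ b x)
    (hc : ∀ x ∈ T, ∀ y ∈ T, (t : ℤ) ∣ x - y) :
    ∑ x ∈ T, min (V : ℝ) t / √(min (V : ℝ) (b x)) ≤
      (4 + 4 * f.natDegree *
        (((Finset.Icc 1 Q).filter (fun a => a.primeFactors ⊆ D.primeFactors)).card : ℝ)) * √(V : ℝ) := by
  have htr : (0 : ℝ) < t := by exact_mod_cast ht
  have hVr : (0 : ℝ) < V := by exact_mod_cast hV
  set Sm := (Finset.Icc 1 Q).filter (fun a => a.primeFactors ⊆ D.primeFactors) with hSm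
  rw [← Finset.sum_filter_add_sum_filter_not T (fun x => V ≤ b x), add_mul]
  apply add_le_add
  · have h1 : ∀ x ∈ T.filter (fun x => V ≤ b x), min (V : ℝ) t / √(min (V : ℝ) (b x)) =
        min (V : ℝ) t / √(V : ℝ) := by
      intro x hx
      rw [min_eq_left (a := (V : ℝ)) (b := (b x : ℝ))]
      exact_mod_cast (Finset.mem_filter.1 hx).2
    rw [Finset.sum_congr rfl h1, Finset.sum_const, nsmul_eq_mul]
    have h2 := kg_class_card V t ht (T.filter (fun x => V ≤ b x))
      (fun x hx => hT x (Finset.mem_filter.1 hx).1)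
      (fun x hx y hy => hc x (Finset.mem_filter.1 hx).1 y (Finset.mem_filter.1 hy).1)
    have h3 : (2 * V / t + 2) * min (V : ℝ) t ≤ 4 * V := by
      rw [add_mul]
      have h4 : 2 * V / t * min (V : ℝ) t ≤ 2 * V := by
        calc 2 * V / t * min (V : ℝ) t ≤ 2 * V / t * t := by gcongr; exact min_le_right _ _
          _ = 2 * V := by field_simp
      have h5 : min (V : ℝ) t ≤ V := min_le_left _ _
      linarith
    have hs : 0 < √(V : ℝ) := Real.sqrt_pos.2 hVr
    rw [← mul_div_assoc, div_le_iff₀ hs, mul_assoc, Real.mul_self_sqrt hVr.le]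
    refine le_trans ?_ h3
    gcongr
  · set T2 := T.filter (fun x => ¬ V ≤ b x) with hT2
    have hT2m : ∀ x ∈ T2, x ∈ T ∧ b x < V := fun x hx => by
      rw [hT2, Finset.mem_filter, not_le] at hx; exact hx
    have hpos : ∀ x ∈ T, a x ≠ 0 ∧ b x ≠ 0 := by
      intro x hx
      have := hab x hx
      have h1 := Int.natAbs_ne_zero.2 (h0 x hx)
      rw [this] at h1
      exact mul_ne_zero_iff.1 h1
    have hmaps : ∀ x ∈ T2, (a x, b x / t) ∈ Sm ×ˢ Finset.Icc 1 (V / t) := by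
      intro x hx
      obtain ⟨hxT, hxV⟩ := hT2m x hx
      have hp := hpos x hxT
      rw [Finset.mem_product, hSm, Finset.mem_filter, Finset.mem_Icc, Finset.mem_Icc]
      refine ⟨⟨⟨Nat.one_le_iff_ne_zero.2 hp.1, ?_⟩, ha x hxT⟩, ?_, Nat.div_le_div_right hxV.le⟩
      · refine le_trans ?_ (hQ x hxT)
        rw [hab x hxT]
        exact Nat.le_mul_of_pos_right _ (Nat.pos_of_ne_zero hp.2)
      · exact (Nat.one_le_div_iff ht).2 (Nat.le_of_dvd (Nat.pos_of_ne_zero hp.2) (hb x hxT))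
    rw [← Finset.sum_fiberwise_of_maps_to hmaps]
    have hfib : ∀ p ∈ Sm ×ˢ Finset.Icc 1 (V / t),
        ∑ x ∈ T2 with (a x, b x / t) = p, min (V : ℝ) t / √(min (V : ℝ) (b x)) ≤
          2 * f.natDegree * (√(t : ℝ) * (1 / √(p.2 : ℝ))) := by
      intro p hp
      have hcard : ((T2.filter (fun x => (a x, b x / t) = p)).card : ℝ) ≤ 2 * f.natDegree := by
        have := kg_fiber f hf (p.1 * (t * p.2)) (T2.filter (fun x => (a x, b x / t) = p)) (by
          intro x hx
          rw [Finset.mem_filter] at hx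
          obtain ⟨hxT, hxV⟩ := hT2m x hx.1
          rw [hab x hxT, ← hx.2, Nat.mul_div_cancel' (hb x hxT)])
        exact_mod_cast this
      have hterm : ∀ x ∈ T2.filter (fun x => (a x, b x / t) = p),
          min (V : ℝ) t / √(min (V : ℝ) (b x)) ≤ √(t : ℝ) * (1 / √(p.2 : ℝ)) := by
        intro x hx
        rw [Finset.mem_filter] at hx
        obtain ⟨hxT, hxV⟩ := hT2m x hx.1
        have hbx : (b x : ℝ) = t * p.2 := by
          rw [← hx.2]; exact_mod_cast (Nat.mul_div_cancel' (hb x hxT)).symm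
        rw [min_eq_right (a := (V : ℝ)) (b := (b x : ℝ)) (by exact_mod_cast hxV.le), hbx,
          Real.sqrt_mul htr.le]
        calc min (V : ℝ) t / (√(t : ℝ) * √(p.2 : ℝ)) ≤ t / (√(t : ℝ) * √(p.2 : ℝ)) := by
              gcongr; exact min_le_right _ _
          _ = (√(t : ℝ) * √(t : ℝ)) / (√(t : ℝ) * √(p.2 : ℝ)) := by rw [Real.mul_self_sqrt htr.le]
          _ = √(t : ℝ) * (1 / √(p.2 : ℝ)) := by
              rw [mul_div_mul_left _ _ (Real.sqrt_pos.2 htr).ne']; ring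
      calc _ ≤ ∑ x ∈ T2 with (a x, b x / t) = p, √(t : ℝ) * (1 / √(p.2 : ℝ)) :=
            Finset.sum_le_sum hterm
        _ = _ := by rw [Finset.sum_const, nsmul_eq_mul]
        _ ≤ _ := by gcongr
    calc _ ≤ ∑ p ∈ Sm ×ˢ Finset.Icc 1 (V / t), 2 * f.natDegree * (√(t : ℝ) * (1 / √(p.2 : ℝ))) :=
          Finset.sum_le_sum hfib
      _ = Sm.card * (2 * f.natDegree * (√(t : ℝ) * ∑ m ∈ Finset.Icc 1 (V / t), (1 / √(m : ℝ)))) := by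
          rw [Finset.sum_product]
          simp only [← Finset.mul_sum, Finset.sum_const, nsmul_eq_mul]
          ring
      _ ≤ Sm.card * (2 * f.natDegree * (√(t : ℝ) * (2 * √((V / t : ℕ) : ℝ)))) := by
          gcongr; exact kg_sum_rsqrt _
      _ = 4 * f.natDegree * Sm.card * √((t : ℝ) * (V / t : ℕ)) := by
          rw [Real.sqrt_mul htr.le]; ring
      _ ≤ _ := by
          gcongr
          exact_mod_cast Nat.mul_div_le V t

noncomputable def kgw (b : ℤ → ℕ) (V : ℕ) (x z : ℤ) : ℝ :=
  min (V : ℝ) (Nat.gcd (b x) z.natAbs) / √(min (V : ℝ) (b x))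

lemma kg_sum_step (d s : ℕ) (δ : ℝ) (hδ : 0 < δ) : ∃ K : ℝ, 1 ≤ K ∧
    ∀ (f : ℤ[X]) (D V Q : ℕ) (a b : ℤ → ℕ) (S : Finset ℤ) (A B : ℤ[X]),
    0 < f.natDegree → f.natDegree ≤ d → D ≠ 0 → D ≤ Q → 1 ≤ V →
    A * f + B * derivative f = C (D : ℤ) →
    (∀ x ∈ S, -(V : ℤ) ≤ x ∧ x ≤ V) → 
    (∀ x ∈ S, (f.eval x).natAbs ≤ Q) → (∀ x ∈ S, f.eval x ≠ 0) →
    (∀ x ∈ S, (f.eval x).natAbs = a x * b x) →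
    (∀ x ∈ S, (a x).primeFactors ⊆ D.primeFactors) →
    (∀ x ∈ S, Nat.Coprime (b x) D) → 
    ∀ m ≤ s, ∀ u : Fin m → ℤ, (∀ j, u j ∈ S) → 
    ∑ x ∈ S, kgw b V x (∏ j, (x - u j)) ≤ K * (Q : ℝ) ^ δ * √(V : ℝ) := by
  have hη : 0 < δ / (s + 2) := by positivity
  set η := δ / (s + 2) with hηd
  obtain ⟨C1, hC1, hdiv⟩ := kg_divisor_bound η hη
  obtain ⟨C2, hC2, hsm⟩ := kg_smooth_count η hη
  refine ⟨C1 ^ s * (4 + 4 * d * C2), ?_, ?_⟩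
  · have h1 : 1 ≤ C1 ^ s := one_le_pow₀ hC1
    have h2 : 1 ≤ 4 + 4 * d * C2 := by
      have : 0 ≤ 4 * d * C2 := by positivity
      linarith
    exact one_le_mul_of_one_le_of_one_le h1 h2
  intro f D V Q a b S A B hf hfd hD hDQ hV hAB hSV hSQ hS0 hab ha hb m hm u hu
  have hQ1 : 1 ≤ Q := (Nat.one_le_iff_ne_zero.2 hD).trans hDQ
  have hQr : (1 : ℝ) ≤ Q := by exact_mod_cast hQ1
  have hpos : ∀ x ∈ S, a x ≠ 0 ∧ b x ≠ 0 := by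
    intro x hx
    have := hab x hx
    have h1 := Int.natAbs_ne_zero.2 (hS0 x hx)
    rw [this] at h1
    exact mul_ne_zero_iff.1 h1
  have hex : ∀ x : ℤ, ∃ e : Fin m → ℕ, Nat.gcd (b x) (∏ j, (x - u j)).natAbs = ∏ j, e j ∧
      ∀ j, e j ∣ (x - u j).natAbs := by
    intro x
    apply kg_decomp
    have : (∏ j, (x - u j)).natAbs = ∏ j, (x - u j).natAbs := by
      exact map_prod Int.natAbsHom _ _
    rw [this]
    exact Nat.gcd_dvd_right _ _
  choose e he1 he2 using hex
  set H := Fintype.piFinset (fun j => (f.eval (u j)).natAbs.divisors) with hH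
  have hbf : ∀ x ∈ S, (b x : ℤ) ∣ f.eval x := by
    intro x hx
    rw [Int.natCast_dvd, hab x hx]; exact Dvd.intro_left _ rfl
  have hmaps : ∀ x ∈ S, e x ∈ H := by
    intro x hx
    rw [hH, Fintype.mem_piFinset]
    intro j
    rw [Nat.mem_divisors]
    refine ⟨?_, Int.natAbs_ne_zero.2 (hS0 _ (hu j))⟩
    have h1 : e x j ∣ b x := by
      refine (Finset.dvd_prod_of_mem (e x) (Finset.mem_univ j)).trans ?_
      rw [← he1]; exact Nat.gcd_dvd_left _ _
    have h2 : (e x j : ℤ) ∣ f.eval x := (Int.natCast_dvd_natCast.2 h1).trans (hbf x hx)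
    have h3 : (e x j : ℤ) ∣ x - u j := Int.natCast_dvd.2 (he2 x j)
    have h4 : x - u j ∣ f.eval x - f.eval (u j) := sub_dvd_eval_sub _ _ _
    have h5 := (dvd_sub_right h2).1 (h3.trans h4)
    exact Int.natCast_dvd.1 h5
  rw [← Finset.sum_fiberwise_of_maps_to hmaps]
  set Sm := (Finset.Icc 1 Q).filter (fun a => a.primeFactors ⊆ D.primeFactors) with hSm
  have hfib : ∀ h ∈ H, ∑ x ∈ S with e x = h, kgw b V x (∏ j, (x - u j)) ≤
      (4 + 4 * f.natDegree * (Sm.card : ℝ)) * √(V : ℝ) := by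
    intro h hh
    have hm1 : ∀ x ∈ S.filter (fun x => e x = h), x ∈ S ∧ e x = h := fun x hx =>
      Finset.mem_filter.1 hx
    have htb : ∀ x ∈ S.filter (fun x => e x = h), ∏ j, h j ∣ b x := by
      intro x hx
      rw [← (hm1 x hx).2, ← he1]; exact Nat.gcd_dvd_left _ _
    have heq : ∀ x ∈ S.filter (fun x => e x = h), kgw b V x (∏ j, (x - u j)) =
        min (V : ℝ) ((∏ j, h j : ℕ) : ℝ) / √(min (V : ℝ) (b x)) := by
      intro x hx
      rw [kgw, he1, (hm1 x hx).2]
    rw [Finset.sum_congr rfl heq]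
    have hhpos : ∀ j, h j ≠ 0 := by
      intro j hj
      rw [hH, Fintype.mem_piFinset] at hh
      have := hh j
      rw [hj] at this
      simp at this
    apply kg_class_sum f hf D V Q (∏ j, h j) hV
      (Nat.one_le_iff_ne_zero.2 (Finset.prod_ne_zero_iff.2 (fun j _ => hhpos j))) a b _
      (fun x hx => hSV x (hm1 x hx).1) (fun x hx => hSQ x (hm1 x hx).1)
      (fun x hx => hS0 x (hm1 x hx).1) (fun x hx => hab x (hm1 x hx).1)
      (fun x hx => ha x (hm1 x hx).1) htb
    intro x hx y hy
    apply kg_hensel f D A B hAB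
    · exact Nat.Coprime.coprime_dvd_left (htb x hx) (hb x (hm1 x hx).1)
    · exact (Int.natCast_dvd_natCast.2 (htb x hx)).trans (hbf x (hm1 x hx).1)
    · exact (Int.natCast_dvd_natCast.2 (htb y hy)).trans (hbf y (hm1 y hy).1)
    · intro p hp hpt
      obtain ⟨j, -, hj⟩ := (Nat.Prime.prime hp).exists_mem_finset_dvd hpt
      have h1 : (p : ℤ) ∣ x - u j := by
        refine Int.natCast_dvd.2 (hj.trans ?_)
        have := he2 x j
        rwa [(hm1 x hx).2] at this
      have h2 : (p : ℤ) ∣ y - u j := by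
        refine Int.natCast_dvd.2 (hj.trans ?_)
        have := he2 y j
        rwa [(hm1 y hy).2] at this
      have := dvd_sub h1 h2
      rwa [sub_sub_sub_cancel_right] at this
  have hHcard : (H.card : ℝ) ≤ (C1 * (Q : ℝ) ^ η) ^ s := by
    rw [hH, Fintype.card_piFinset]
    push_cast
    have h1 : (1 : ℝ) ≤ C1 * (Q : ℝ) ^ η :=
      one_le_mul_of_one_le_of_one_le hC1 (Real.one_le_rpow hQr hη.le)
    calc ∏ j, (((f.eval (u j)).natAbs.divisors.card : ℕ) : ℝ) ≤ ∏ j : Fin m, (C1 * (Q : ℝ) ^ η) := by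
          apply Finset.prod_le_prod
          · intro j _; positivity
          · intro j _
            refine (hdiv _ (Int.natAbs_ne_zero.2 (hS0 _ (hu j)))).trans ?_
            have := hSQ _ (hu j)
            gcongr
      _ = (C1 * (Q : ℝ) ^ η) ^ m := by simp
      _ ≤ _ := pow_le_pow_right₀ h1 hm
  have hSmc : (Sm.card : ℝ) ≤ C2 * ((Q : ℝ) ^ η * (Q : ℝ) ^ η) := by
    refine (hsm D Q hD hQ1).trans ?_
    rw [← Real.mul_rpow (by positivity) (by positivity)]
    gcongr
  have hQη : 1 ≤ (Q : ℝ) ^ η := Real.one_le_rpow hQr hη.le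
  have hQδ : ((Q : ℝ) ^ η) ^ s * ((Q : ℝ) ^ η * (Q : ℝ) ^ η) = (Q : ℝ) ^ δ := by
    rw [← pow_two, ← pow_add, ← Real.rpow_natCast, ← Real.rpow_mul (by positivity), hηd]
    congr 1; push_cast; field_simp
  calc _ ≤ ∑ h ∈ H, (4 + 4 * f.natDegree * (Sm.card : ℝ)) * √(V : ℝ) := Finset.sum_le_sum hfib
    _ = H.card * ((4 + 4 * f.natDegree * (Sm.card : ℝ)) * √(V : ℝ)) := by
        rw [Finset.sum_const, nsmul_eq_mul]
    _ ≤ (C1 * (Q : ℝ) ^ η) ^ s * ((4 + 4 * d * (C2 * ((Q : ℝ) ^ η * (Q : ℝ) ^ η))) * √(V : ℝ)) := by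
        gcongr
    _ ≤ (C1 * (Q : ℝ) ^ η) ^ s * ((4 * ((Q : ℝ) ^ η * (Q : ℝ) ^ η) + 4 * d * (C2 * ((Q : ℝ) ^ η * (Q : ℝ) ^ η))) * √(V : ℝ)) := by
        gcongr
        nlinarith
    _ = C1 ^ s * (4 + 4 * d * C2) * (((Q : ℝ) ^ η) ^ s * ((Q : ℝ) ^ η * (Q : ℝ) ^ η)) * √(V : ℝ) := by
        rw [mul_pow]; ring
    _ = _ := by rw [hQδ]


noncomputable def kgF (b : ℤ → ℕ) (V : ℕ) {m : ℕ} (u : Fin m → ℤ) : ℝ :=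
  ∏ k, kgw b V (u k) (∏ j ∈ Finset.Ioi k, (u k - u j))

lemma kgw_nonneg (b : ℤ → ℕ) (V : ℕ) (x z : ℤ) : 0 ≤ kgw b V x z := by
  unfold kgw; positivity

lemma kgF_nonneg (b : ℤ → ℕ) (V : ℕ) {m : ℕ} (u : Fin m → ℤ) : 0 ≤ kgF b V u :=
  Finset.prod_nonneg (fun _ _ => kgw_nonneg _ _ _ _)

lemma kgF_cons (b : ℤ → ℕ) (V : ℕ) {m : ℕ} (x : ℤ) (u : Fin m → ℤ) :
    kgF b V (Fin.cons x u : Fin (m + 1) → ℤ) = kgw b V x (∏ j, (x - u j)) * kgF b V u := by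
  unfold kgF
  rw [Fin.prod_univ_succ]
  simp [Fin.prod_Ioi_succ]

lemma kg_sum_cons {m : ℕ} (S : Finset ℤ) (g : (Fin (m + 1) → ℤ) → ℝ) :
    ∑ u ∈ Fintype.piFinset (fun _ : Fin (m + 1) => S), g u =
      ∑ u ∈ Fintype.piFinset (fun _ : Fin m => S), ∑ x ∈ S, g (Fin.cons x u) := by
  rw [← Finset.sum_product']
  symm
  refine Finset.sum_nbij' (fun p => Fin.cons p.2 p.1) (fun u => (Fin.tail u, u 0)) ?_ ?_ ?_ ?_ ?_
  · intro p hp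
    rw [Finset.mem_product, Fintype.mem_piFinset] at hp
    rw [Fintype.mem_piFinset]
    intro i
    refine Fin.cases ?_ ?_ i
    · simpa using hp.2
    · intro j; simpa using hp.1 j
  · intro u hu
    rw [Fintype.mem_piFinset] at hu
    rw [Finset.mem_product, Fintype.mem_piFinset]
    exact ⟨fun j => hu _, hu 0⟩
  · intro p _; simp
  · intro u _; simp
  · intro p _; rfl

lemma kg_seq (b : ℤ → ℕ) (V s : ℕ) (S : Finset ℤ) (B : ℝ) (hB : 0 ≤ B)
    (h : ∀ m ≤ s, ∀ u : Fin m → ℤ, (∀ j, u j ∈ S) → ∑ x ∈ S, kgw b V x (∏ j, (x - u j)) ≤ B) :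
    ∀ m ≤ s, ∑ u ∈ Fintype.piFinset (fun _ : Fin m => S), kgF b V u ≤ B ^ m := by
  intro m
  induction m with
  | zero => intro _; simp [kgF]
  | succ m ih =>
    intro hm
    rw [kg_sum_cons]
    simp only [kgF_cons]
    calc ∑ u ∈ Fintype.piFinset (fun _ : Fin m => S), ∑ x ∈ S, kgw b V x (∏ j, (x - u j)) * kgF b V u
        ≤ ∑ u ∈ Fintype.piFinset (fun _ : Fin m => S), B * kgF b V u := by
          apply Finset.sum_le_sum
          intro u hu
          rw [← Finset.sum_mul]
          exact mul_le_mul_of_nonneg_right (h m (by omega) u (Fintype.mem_piFinset.1 hu))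
            (kgF_nonneg _ _ _)
      _ = B * ∑ u ∈ Fintype.piFinset (fun _ : Fin m => S), kgF b V u := by rw [Finset.mul_sum]
      _ ≤ B * B ^ m := by gcongr; exact ih (by omega)
      _ = B ^ (m + 1) := by ring

lemma kgF_rev (b : ℤ → ℕ) (V : ℕ) {m : ℕ} (u : Fin m → ℤ) :
    kgF b V (fun i => u i.rev) = ∏ k, kgw b V (u k) (∏ j ∈ Finset.Iio k, (u k - u j)) := by
  unfold kgF
  refine Fintype.prod_equiv Fin.revPerm _ _ ?_
  intro k
  simp only [Fin.revPerm_apply]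
  congr 1
  refine Finset.prod_nbij' Fin.rev Fin.rev ?_ ?_ ?_ ?_ ?_
  · intro j hj; simpa using hj
  · intro j hj
    simp only [Finset.mem_Iio, Finset.mem_Ioi] at hj ⊢
    rw [← Fin.rev_lt_rev, Fin.rev_rev]; exact hj
  · intro j _; simp
  · intro j _; simp
  · intro j _; simp

lemma kgw_mul (b : ℤ → ℕ) (V : ℕ) (hV : 1 ≤ V) (x z z' : ℤ) (hb : b x ≠ 0)
    (h : (b x : ℤ) ∣ z * z') : 1 ≤ kgw b V x z * kgw b V x z' := by
  unfold kgw
  have hbp : 1 ≤ b x := Nat.one_le_iff_ne_zero.2 hb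
  set t := Nat.gcd (b x) z.natAbs with ht
  set t' := Nat.gcd (b x) z'.natAbs with ht'
  have h1 : b x ∣ t * t' := by
    have h2 : b x ∣ z.natAbs * z'.natAbs := by
      rw [← Int.natAbs_mul]; exact Int.natCast_dvd.1 h
    have h3 := Nat.gcd_mul_right_dvd_mul_gcd (b x) z.natAbs z'.natAbs
    rwa [Nat.gcd_eq_left h2] at h3
  have htp : 1 ≤ t := Nat.gcd_pos_of_pos_left _ hbp
  have htp' : 1 ≤ t' := Nat.gcd_pos_of_pos_left _ hbp
  have h4 : b x ≤ t * t' := Nat.le_of_dvd (by positivity) h1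
  have hV' : (1 : ℝ) ≤ V := by exact_mod_cast hV
  have hbr : (1 : ℝ) ≤ b x := by exact_mod_cast hbp
  have htr : (1 : ℝ) ≤ t := by exact_mod_cast htp
  have htr' : (1 : ℝ) ≤ t' := by exact_mod_cast htp'
  have h5 : (b x : ℝ) ≤ t * t' := by exact_mod_cast h4
  have hw : 0 < min (V : ℝ) (b x) := lt_min (by linarith) (by linarith)
  rw [div_mul_div_comm, Real.mul_self_sqrt hw.le, le_div_iff₀ hw, one_mul]
  rcases le_total (V : ℝ) t with h6 | h6
  · rw [min_eq_left h6]
    calc min (V : ℝ) (b x) ≤ V * 1 := by rw [mul_one]; exact min_le_left _ _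
      _ ≤ V * min (V : ℝ) t' := by gcongr; exact le_min hV' htr'
  · rcases le_total (V : ℝ) t' with h7 | h7
    · rw [min_eq_left h7]
      calc min (V : ℝ) (b x) ≤ 1 * V := by rw [one_mul]; exact min_le_left _ _
        _ ≤ min (V : ℝ) t * V := by gcongr; exact le_min hV' htr
    · rw [min_eq_right h6, min_eq_right h7]
      exact (min_le_right _ _).trans h5

lemma kg_count (d s : ℕ) (δ : ℝ) (hδ : 0 < δ) : ∃ K : ℝ, 1 ≤ K ∧
    ∀ (f : ℤ[X]) (D V Q : ℕ) (A B : ℤ[X]) (c : Fin s → ℤ) (G : Finset (Fin s → ℤ)),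
    0 < f.natDegree → f.natDegree ≤ d → D ≠ 0 → D ≤ Q → 1 ≤ V →
    A * f + B * derivative f = C (D : ℤ) → (∀ k, c k ∣ (D : ℤ)) →
    (∀ y ∈ G, ∀ k, (-(V : ℤ) ≤ y k ∧ y k ≤ V) ∧ (f.eval (y k)).natAbs ≤ Q ∧ f.eval (y k) ≠ 0 ∧
      f.eval (y k) ∣ c k * ∏ j ∈ Finset.univ.erase k, (y k - y j)) →
    (G.card : ℝ) ≤ K * (Q : ℝ) ^ δ * √(V : ℝ) ^ s := by
  obtain ⟨K, hK, hstep⟩ := kg_sum_step d s (δ / (s + 1)) (by positivity)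
  refine ⟨K ^ s, one_le_pow₀ hK, ?_⟩
  intro f D V Q A B c G hf hfd hD hDQ hV hAB hc hG
  have hQ1 : 1 ≤ Q := (Nat.one_le_iff_ne_zero.2 hD).trans hDQ
  have hQr : (1 : ℝ) ≤ Q := by exact_mod_cast hQ1
  have hex : ∀ x : ℤ, ∃ a b : ℕ, f.eval x ≠ 0 → ((f.eval x).natAbs = a * b ∧
      a.primeFactors ⊆ D.primeFactors ∧ Nat.Coprime b D) := by
    intro x
    by_cases hx : f.eval x = 0
    · exact ⟨0, 0, fun h => absurd hx h⟩
    · obtain ⟨a, b, h⟩ := kg_coprime_split D hD _ (Int.natAbs_ne_zero.2 hx)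
      exact ⟨a, b, fun _ => h⟩
  choose a b hab using hex
  set S := (Finset.Icc (-(V : ℤ)) V).filter (fun x => f.eval x ≠ 0 ∧ (f.eval x).natAbs ≤ Q) with hS
  have hSm : ∀ x ∈ S, (-(V : ℤ) ≤ x ∧ x ≤ V) ∧ f.eval x ≠ 0 ∧ (f.eval x).natAbs ≤ Q := by
    intro x hx
    rwa [hS, Finset.mem_filter, Finset.mem_Icc] at hx
  have hB := hstep f D V Q a b S A B hf hfd hD hDQ hV hAB (fun x hx => (hSm x hx).1)
    (fun x hx => (hSm x hx).2.2) (fun x hx => (hSm x hx).2.1)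
    (fun x hx => (hab x (hSm x hx).2.1).1) (fun x hx => (hab x (hSm x hx).2.1).2.1)
    (fun x hx => (hab x (hSm x hx).2.1).2.2)
  set Bd : ℝ := K * (Q : ℝ) ^ (δ / (s + 1)) * √(V : ℝ) with hBd
  have hBd0 : 0 ≤ Bd := by positivity
  have hseq := kg_seq b V s S Bd hBd0 hB s le_rfl
  have hGS : G ⊆ Fintype.piFinset (fun _ : Fin s => S) := by
    intro y hy
    rw [Fintype.mem_piFinset]
    intro k
    have := hG y hy k
    rw [hS, Finset.mem_filter, Finset.mem_Icc]
    exact ⟨this.1, this.2.2.1, this.2.1⟩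
  have hsum1 : ∑ y ∈ G, kgF b V y ≤ Bd ^ s :=
    (Finset.sum_le_sum_of_subset_of_nonneg hGS (fun _ _ _ => kgF_nonneg _ _ _)).trans hseq
  have hsum2 : ∑ y ∈ G, kgF b V (fun i => y i.rev) ≤ Bd ^ s := by
    have hinj : Set.InjOn (fun (y : Fin s → ℤ) => (fun i => y (Fin.rev i))) (G : Set (Fin s → ℤ)) := by
      intro y _ y' _ h
      funext i
      have := congrFun h i.rev
      simpa using this
    rw [← Finset.sum_image (s := G) (g := fun (y : Fin s → ℤ) => (fun i => y (Fin.rev i)))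
      (f := fun y => kgF b V y) hinj]
    refine (Finset.sum_le_sum_of_subset_of_nonneg ?_ (fun _ _ _ => kgF_nonneg _ _ _)).trans hseq
    intro y hy
    rw [Finset.mem_image] at hy
    obtain ⟨y', hy', rfl⟩ := hy
    have := Fintype.mem_piFinset.1 (hGS hy')
    rw [Fintype.mem_piFinset]
    exact fun i => this _
  have hone : ∀ y ∈ G, (1 : ℝ) ≤ (kgF b V y + kgF b V (fun i => y i.rev)) / 2 := by
    intro y hy
    have hprod : 1 ≤ kgF b V y * kgF b V (fun i => y i.rev) := by
      rw [kgF_rev, kgF, ← Finset.prod_mul_distrib]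
      have : ∀ k ∈ (Finset.univ : Finset (Fin s)), (1 : ℝ) ≤ kgw b V (y k) (∏ j ∈ Finset.Ioi k, (y k - y j)) *
          kgw b V (y k) (∏ j ∈ Finset.Iio k, (y k - y j)) := by
        intro k _
        obtain ⟨h1, h2, h3, h4⟩ := hG y hy k
        obtain ⟨h5, h6, h7⟩ := hab (y k) h3
        have hb0 : b (y k) ≠ 0 := by
          intro h; rw [h, mul_zero] at h5; exact h3 (Int.natAbs_eq_zero.1 h5)
        apply kgw_mul b V hV _ _ _ hb0
        have h8 : (b (y k) : ℤ) ∣ c k * ∏ j ∈ Finset.univ.erase k, (y k - y j) := by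
          refine dvd_trans ?_ h4
          rw [Int.natCast_dvd, h5]; exact Dvd.intro_left _ rfl
        have h9 : IsCoprime (b (y k) : ℤ) (c k) := by
          have : IsCoprime (b (y k) : ℤ) (D : ℤ) := Nat.isCoprime_iff_coprime.2 h7
          exact this.of_isCoprime_of_dvd_right (hc k)
        have h10 := h9.dvd_of_dvd_mul_left h8
        have h11 : Finset.univ.erase k = Finset.Ioi k ∪ Finset.Iio k := by
          ext j
          simp only [Finset.mem_erase, Finset.mem_univ, and_true, Finset.mem_union, Finset.mem_Ioi,
            Finset.mem_Iio]
          exact ⟨fun h => (lt_or_gt_of_ne h).symm, fun h => h.elim (fun h => h.ne') (fun h => h.ne)⟩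
        rwa [h11, Finset.prod_union (by
          rw [Finset.disjoint_left]; intro j h1 h2
          rw [Finset.mem_Ioi] at h1; rw [Finset.mem_Iio] at h2; exact lt_asymm h1 h2)] at h10
      calc (1 : ℝ) = ∏ k : Fin s, (1 : ℝ) := by simp
        _ ≤ _ := Finset.prod_le_prod (fun _ _ => zero_le_one) this
    have h1 := kgF_nonneg b V y
    have h2 := kgF_nonneg b V (fun i => y i.rev)
    nlinarith [sq_nonneg (kgF b V y - kgF b V (fun i => y i.rev))]
  have hBds : Bd ^ s ≤ K ^ s * (Q : ℝ) ^ δ * √(V : ℝ) ^ s := by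
    rw [hBd, mul_pow, mul_pow]
    gcongr
    rw [← Real.rpow_natCast, ← Real.rpow_mul (by positivity)]
    apply Real.rpow_le_rpow_of_exponent_le hQr
    rw [div_mul_eq_mul_div, div_le_iff₀ (by positivity)]
    nlinarith
  calc (G.card : ℝ) = ∑ y ∈ G, (1 : ℝ) := by simp
    _ ≤ ∑ y ∈ G, (kgF b V y + kgF b V (fun i => y i.rev)) / 2 := Finset.sum_le_sum hone
    _ = (∑ y ∈ G, kgF b V y + ∑ y ∈ G, kgF b V (fun i => y i.rev)) / 2 := by
        rw [← Finset.sum_div, Finset.sum_add_distrib]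
    _ ≤ Bd ^ s := by linarith
    _ ≤ _ := hBds


noncomputable def kgP {s : ℕ} (c y : Fin s → ℤ) : ℤ[X] :=
  ∑ k, C (c k) * ∏ j ∈ Finset.univ.erase k, (X - C (y j))

lemma kgP_eval_self {s : ℕ} (c y : Fin s → ℤ) (k : Fin s) :
    (kgP c y).eval (y k) = c k * ∏ j ∈ Finset.univ.erase k, (y k - y j) := by
  unfold kgP
  rw [eval_finsetSum, Finset.sum_eq_single k]
  · simp [eval_mul, eval_prod]
  · intro i _ hik
    rw [eval_mul, eval_prod, Finset.prod_eq_zero (i := k) (by simp [Ne.symm hik]) (by simp), mul_zero]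
  · simp

lemma kg_prod_coeff {ι : Type*} [DecidableEq ι] (J : Finset ι) (y : ι → ℤ) (V : ℤ) (hV : 0 ≤ V)
    (hy : ∀ j ∈ J, |y j| ≤ V) (i : ℕ) :
    |(∏ j ∈ J, (X - C (y j))).coeff i| * V ^ i ≤ 2 ^ J.card * V ^ J.card := by
  induction J using Finset.induction_on generalizing i with
  | empty =>
    rw [Finset.prod_empty, coeff_one]
    split_ifs with h
    · subst h; simp
    · simp
  | insert a J ha ih =>
    rw [Finset.prod_insert ha, Finset.card_insert_of_notMem ha, sub_mul]
    have hJ : ∀ j ∈ J, |y j| ≤ V := fun j hj => hy j (Finset.mem_insert_of_mem hj)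
    have hya := hy a (Finset.mem_insert_self _ _)
    have h0 : 0 ≤ V ^ i := by positivity
    have h1 : |(C (y a) * ∏ j ∈ J, (X - C (y j))).coeff i| * V ^ i ≤ V * (2 ^ J.card * V ^ J.card) := by
      rw [coeff_C_mul, abs_mul, mul_assoc]
      exact mul_le_mul hya (ih hJ i) (by positivity) hV
    have h2 : |(X * ∏ j ∈ J, (X - C (y j))).coeff i| * V ^ i ≤ V * (2 ^ J.card * V ^ J.card) := by
      cases i with
      | zero => simp; positivity
      | succ i =>
        rw [coeff_X_mul, pow_succ, ← mul_assoc, mul_comm _ V]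
        exact mul_le_mul_of_nonneg_left (ih hJ i) hV
    rw [coeff_sub]
    calc _ ≤ (|(X * ∏ j ∈ J, (X - C (y j))).coeff i| + |(C (y a) * ∏ j ∈ J, (X - C (y j))).coeff i|) * V ^ i := by
          gcongr; exact abs_sub _ _
      _ ≤ V * (2 ^ J.card * V ^ J.card) + V * (2 ^ J.card * V ^ J.card) := by
          rw [add_mul]; exact add_le_add h2 h1
      _ = _ := by ring

lemma kgP_coeff {s : ℕ} (c y : Fin s → ℤ) (V R : ℤ) (hV : 0 ≤ V) (hy : ∀ j, |y j| ≤ V)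
    (hc : ∀ j, |c j| ≤ R) (i : ℕ) :
    |(kgP c y).coeff i| * V ^ i ≤ (s * R * 2 ^ (s - 1)) * V ^ (s - 1) := by
  unfold kgP
  rw [finsetSum_coeff]
  have h0 : 0 ≤ V ^ i := by positivity
  calc _ ≤ (∑ k, |(C (c k) * ∏ j ∈ Finset.univ.erase k, (X - C (y j))).coeff i|) * V ^ i := by
        gcongr; exact Finset.abs_sum_le_sum_abs _ _
    _ = ∑ k, |(C (c k) * ∏ j ∈ Finset.univ.erase k, (X - C (y j))).coeff i| * V ^ i := by
        rw [Finset.sum_mul]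
    _ ≤ ∑ k : Fin s, R * (2 ^ (s - 1) * V ^ (s - 1)) := by
        apply Finset.sum_le_sum
        intro k _
        rw [coeff_C_mul, abs_mul, mul_assoc]
        have := kg_prod_coeff (Finset.univ.erase k) y V hV (fun j _ => hy j) i
        rw [Finset.card_erase_of_mem (Finset.mem_univ k), Finset.card_univ, Fintype.card_fin] at this
        exact mul_le_mul (hc k) this (by positivity) ((abs_nonneg _).trans (hc k))
    _ = _ := by simp; ring

lemma kgP_natDegree {s : ℕ} (c y : Fin s → ℤ) (hc : ∑ k, c k = 0) :
    (kgP c y).natDegree ≤ s - 1 - 1 := by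
  have hdeg : ∀ k : Fin s, (∏ j ∈ Finset.univ.erase k, (X - C (y j))).natDegree = s - 1 := by
    intro k
    rw [natDegree_prod_of_monic _ _ (fun j _ => monic_X_sub_C _)]
    rw [Finset.sum_congr rfl (fun j _ => natDegree_X_sub_C _)]
    simp
  apply natDegree_le_pred
  · apply natDegree_sum_le_of_forall_le
    intro k _
    exact (natDegree_C_mul_le _ _).trans (hdeg k).le
  · unfold kgP
    rw [finsetSum_coeff, ← hc]
    apply Finset.sum_congr rfl
    intro k _
    have : (∏ j ∈ Finset.univ.erase k, (X - C (y j))).Monic :=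
      monic_prod_of_monic _ _ (fun j _ => monic_X_sub_C _)
    have h2 := this.coeff_natDegree
    rw [hdeg k] at h2
    rw [coeff_C_mul, h2, mul_one]

lemma kgP_eval_zmod {s q : ℕ} (c y : Fin s → ℤ) (lam : ℤ)
    (hu : ∀ k, IsUnit (((lam - y k : ℤ)) : ZMod q))
    (h : ∑ k, ((c k : ℤ) : ZMod q) * (((lam - y k : ℤ)) : ZMod q)⁻¹ = 0) :
    (q : ℤ) ∣ (kgP c y).eval lam := by
  rw [← ZMod.intCast_zmod_eq_zero_iff_dvd]
  unfold kgP
  rw [eval_finsetSum]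
  have h2 : (∏ j, ((lam - y j : ℤ) : ZMod q)) *
      ∑ k, ((c k : ℤ) : ZMod q) * (((lam - y k : ℤ)) : ZMod q)⁻¹ = 0 := by rw [h, mul_zero]
  rw [Finset.mul_sum] at h2
  rw [Int.cast_sum, ← h2]
  apply Finset.sum_congr rfl
  intro k _
  rw [← Finset.mul_prod_erase Finset.univ _ (Finset.mem_univ k)]
  have h3 := ZMod.mul_inv_of_unit _ (hu k)
  rw [eval_mul, eval_C, eval_prod, Int.cast_mul, Int.cast_prod]
  simp only [eval_sub, eval_X, eval_C]
  linear_combination (-(c k : ZMod q) * (∏ j ∈ Finset.univ.erase k, ((lam - y j : ℤ) : ZMod q))) * h3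

lemma kg_res_bound (p g : ℤ[X]) (m n : ℕ) (V M : ℤ) (hV : 0 < V) (hM : 0 ≤ M)
    (hp : ∀ i, |p.coeff i| * V ^ i ≤ M) (hg : ∀ i, |g.coeff i| * V ^ i ≤ M) :
    |resultant p g m n| * V ^ (m * n) ≤ (Nat.factorial (m + n) : ℤ) * M ^ (m + n) := by
  set sh : Fin (m + n) → ℕ := fun j => Fin.addCases (fun j => (j : ℕ)) (fun j => (j : ℕ)) j with hsh
  have hS : ∀ i j, |sylvester p g m n i j| * V ^ (i : ℕ) ≤ M * V ^ sh j := by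
    intro i j
    have aux : ∀ (f : ℤ[X]) (a b : ℕ), (∀ i, |f.coeff i| * V ^ i ≤ M) →
        |(if (i : ℕ) ∈ Set.Icc a (a + b) then f.coeff (i - a) else 0)| * V ^ (i : ℕ)
          ≤ M * V ^ a := by
      intro f a b hf
      split_ifs with h
      · have h1 : (i : ℕ) = (i - a) + a := by have := h.1; omega
        have h2 := hf (i - a)
        calc |f.coeff (i - a)| * V ^ (i : ℕ) = (|f.coeff (i - a)| * V ^ ((i : ℕ) - a)) * V ^ a := by
              rw [mul_assoc, ← pow_add, ← h1]
          _ ≤ M * V ^ a := by gcongr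
      · simp; positivity
    refine Fin.addCases (fun j => ?_) (fun j => ?_) j
    · simp only [sylvester, hsh, Matrix.of_apply, Fin.addCases_left]
      exact aux g j n hg
    · simp only [sylvester, hsh, Matrix.of_apply, Fin.addCases_right]
      exact aux p j m hp
  have hsum : ∑ i : Fin (m + n), (i : ℕ) = (∑ j, sh j) + m * n := by
    rw [Fin.sum_univ_add, Fin.sum_univ_add]
    simp [hsh, Finset.sum_add_distrib]
    ring
  have hσ : ∀ σ : Equiv.Perm (Fin (m + n)),
      |∏ i, sylvester p g m n (σ i) i| * V ^ (m * n) ≤ M ^ (m + n) := by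
    intro σ
    have h1 : ∏ i, (|sylvester p g m n (σ i) i| * V ^ ((σ i : Fin (m + n)) : ℕ)) ≤ ∏ i, M * V ^ sh i :=
      Finset.prod_le_prod (fun i _ => by positivity) (fun i _ => hS _ _)
    rw [Finset.prod_mul_distrib, Finset.prod_mul_distrib, Finset.prod_pow_eq_pow_sum,
      Finset.prod_pow_eq_pow_sum, Equiv.sum_comp σ (fun i => (i : ℕ)), hsum, pow_add,
      ← Finset.abs_prod] at h1
    simp only [Finset.prod_const, Finset.card_univ, Fintype.card_fin] at h1
    have h3 : 0 < V ^ (∑ j, sh j) := by positivity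
    refine le_of_mul_le_mul_right ?_ h3
    linarith [h1]
  unfold resultant
  rw [Matrix.det_apply]
  calc _ ≤ (∑ σ : Equiv.Perm (Fin (m + n)), |∏ i, sylvester p g m n (σ i) i|) * V ^ (m * n) := by
        gcongr
        refine (Finset.abs_sum_le_sum_abs _ _).trans (Finset.sum_le_sum fun σ _ => ?_)
        rcases Int.units_eq_one_or (Equiv.Perm.sign σ) with h | h <;> simp [h, Units.smul_def]
    _ ≤ ∑ σ : Equiv.Perm (Fin (m + n)), M ^ (m + n) := by
        rw [Finset.sum_mul]
        exact Finset.sum_le_sum fun σ _ => hσ σ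
    _ = _ := by simp [Fintype.card_perm]


lemma kg_mignotte (f h : ℤ[X]) (hP : f * h ≠ 0) (M : ℤ) (hM : ∀ i, |(f * h).coeff i| ≤ M) (i : ℕ) :
    |f.coeff i| ≤ 2 ^ (f * h).natDegree * (((f * h).natDegree + 1 : ℕ) * M) := by
  have hinj : Function.Injective (Int.castRingHom ℂ) := Int.cast_injective
  have hh : h ≠ 0 := right_ne_zero_of_mul hP
  have hf : f ≠ 0 := left_ne_zero_of_mul hP
  have h1 : 1 ≤ (h.map (Int.castRingHom ℂ)).mahlerMeasure := by
    apply one_le_mahlerMeasure_of_one_le_norm_leadingCoeff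
    rw [leadingCoeff_map_of_injective hinj]
    have : (1 : ℤ) ≤ |h.leadingCoeff| := Int.one_le_abs (leadingCoeff_ne_zero.mpr hh)
    simp only [eq_intCast, Complex.norm_intCast]
    exact_mod_cast this
  have h2 := norm_coeff_le_choose_mul_mahlerMeasure_of_one_le_mahlerMeasure i
    (f.map (Int.castRingHom ℂ)) _ h1
  rw [← Polynomial.map_mul, natDegree_map_eq_of_injective hinj] at h2
  have h3 := mahlerMeasure_le_sum_norm_coeff ((f * h).map (Int.castRingHom ℂ))
  rw [sum_over_range _ (by simp), natDegree_map_eq_of_injective hinj] at h3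
  have h4 : ∑ a ∈ Finset.range ((f * h).natDegree + 1), ‖((f * h).map (Int.castRingHom ℂ)).coeff a‖
      ≤ ((f * h).natDegree + 1 : ℕ) * (M : ℝ) := by
    have : ∀ a ∈ Finset.range ((f * h).natDegree + 1),
        ‖((f * h).map (Int.castRingHom ℂ)).coeff a‖ ≤ (M : ℝ) := by
      intro a _
      rw [coeff_map]
      simp only [eq_intCast, Complex.norm_intCast]
      exact_mod_cast hM a
    refine (Finset.sum_le_sum this).trans ?_
    simp
  have h5 : ((f.natDegree.choose i : ℕ) : ℝ) ≤ 2 ^ (f * h).natDegree := by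
    have : f.natDegree.choose i ≤ 2 ^ (f * h).natDegree :=
      (Nat.choose_le_two_pow _ _).trans (Nat.pow_le_pow_right (by norm_num)
        (by rw [natDegree_mul hf hh]; omega))
    exact_mod_cast this
  have h6 : ‖(f.map (Int.castRingHom ℂ)).coeff i‖ ≤
      2 ^ (f * h).natDegree * (((f * h).natDegree + 1 : ℕ) * (M : ℝ)) :=
    h2.trans (mul_le_mul h5 (h3.trans h4) (mahlerMeasure_nonneg _) (by positivity))
  rw [coeff_map] at h6
  simp only [eq_intCast, Complex.norm_intCast] at h6
  exact_mod_cast h6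

lemma kg_isCoprime_of_isUnit {a b : ℚ[X]} (h : IsUnit a) : IsCoprime a b := by
  obtain ⟨u, rfl⟩ := h
  exact ⟨((u⁻¹ : (ℚ[X])ˣ) : ℚ[X]), 0, by simp⟩

lemma kg_factors (P : ℤ[X]) (hP : P ≠ 0) : ∃ F : Finset ℤ[X], F.card ≤ P.natDegree ∧
    (∀ f ∈ F, Irreducible f ∧ 0 < f.natDegree ∧ f ∣ P) ∧
    ∀ E : ℤ[X], ¬ IsCoprime (P.map (Int.castRingHom ℚ)) (E.map (Int.castRingHom ℚ)) →
      ∃ f ∈ F, f ∣ E := by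
  classical
  set T := UniqueFactorizationMonoid.factors P with hT
  have hass : Associated T.prod P := UniqueFactorizationMonoid.factors_prod hP
  have hirr : ∀ f ∈ T, Irreducible f := fun f hf => UniqueFactorizationMonoid.irreducible_of_factor f hf
  refine ⟨(T.filter (fun f => 0 < f.natDegree)).toFinset, ?_, ?_, ?_⟩
  · refine (Multiset.toFinset_card_le _).trans ?_
    have h0 : (0 : ℤ[X]) ∉ T := fun h => (hirr 0 h).ne_zero rfl
    have hd : P.natDegree = (T.map natDegree).sum := by
      rw [← natDegree_multiset_prod T h0]
      have := degree_eq_degree_of_associated hass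
      exact (natDegree_eq_of_degree_eq this).symm
    rw [hd]
    have : ∀ S : Multiset ℤ[X], (S.filter (fun f => 0 < f.natDegree)).card ≤ (S.map natDegree).sum := by
      intro S
      induction S using Multiset.induction_on with
      | empty => simp
      | cons a S ih =>
        rw [Multiset.filter_cons, Multiset.map_cons, Multiset.sum_cons, Multiset.card_add]
        refine add_le_add ?_ ih
        split_ifs with h
        · simp; omega
        · simp
    exact this T
  · intro f hf
    rw [Multiset.mem_toFinset, Multiset.mem_filter] at hf
    exact ⟨hirr f hf.1, hf.2, UniqueFactorizationMonoid.dvd_of_mem_factors hf.1⟩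
  · intro E hE
    by_contra hcon
    push Not at hcon
    apply hE
    have hall : ∀ f ∈ T, IsCoprime (f.map (Int.castRingHom ℚ)) (E.map (Int.castRingHom ℚ)) := by
      intro f hf
      by_cases hd : 0 < f.natDegree
      · have hnd := hcon f (by rw [Multiset.mem_toFinset, Multiset.mem_filter]; exact ⟨hf, hd⟩)
        have hprim := (hirr f hf).isPrimitive hd.ne'
        have hi := (IsPrimitive.Int.irreducible_iff_irreducible_map_cast hprim).mp (hirr f hf)
        rw [IsPrimitive.Int.dvd_iff_map_cast_dvd_map_cast _ _ hprim] at hnd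
        exact (hi.coprime_iff_not_dvd).mpr hnd
      · have hd0 : f.natDegree = 0 := by omega
        rw [natDegree_eq_zero] at hd0
        obtain ⟨x, rfl⟩ := hd0
        have hx : x ≠ 0 := by
          rintro rfl
          exact (hirr _ hf).ne_zero (by simp)
        have : IsUnit ((C x : ℤ[X]).map (Int.castRingHom ℚ)) := by
          rw [map_C]
          apply IsUnit.map
          simpa using hx
        exact kg_isCoprime_of_isUnit this
    have hprod : ∀ S : Multiset ℤ[X], (∀ f ∈ S, IsCoprime (f.map (Int.castRingHom ℚ)) (E.map (Int.castRingHom ℚ))) →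
        IsCoprime (S.prod.map (Int.castRingHom ℚ)) (E.map (Int.castRingHom ℚ)) := by
      intro S
      induction S using Multiset.induction_on with
      | empty => intro _; simp [isCoprime_one_left]
      | cons a S ih =>
        intro h
        rw [Multiset.prod_cons, Polynomial.map_mul]
        exact (h a (Multiset.mem_cons_self _ _)).mul_left (ih fun f hf => h f (Multiset.mem_cons_of_mem hf))
    obtain ⟨u, hu⟩ := hass
    rw [← hu, Polynomial.map_mul]
    refine (hprod T hall).mul_left (kg_isCoprime_of_isUnit ?_)
    exact u.isUnit.map (mapRingHom (Int.castRingHom ℚ))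

lemma kg_res_ne (f g : ℤ[X]) (h : IsCoprime (f.map (Int.castRingHom ℚ)) (g.map (Int.castRingHom ℚ))) :
    resultant f g ≠ 0 := by
  have h1 := resultant_ne_zero _ _ h
  have hinj : Function.Injective (Int.castRingHom ℚ) := Int.cast_injective
  rw [natDegree_map_eq_of_injective hinj, natDegree_map_eq_of_injective hinj, resultant_map_map] at h1
  intro h0
  rw [h0] at h1
  simp at h1

lemma kg_disc (f : ℤ[X]) (hf : Irreducible f) (hd : 0 < f.natDegree) (H : ℤ) (hH : 1 ≤ H)
    (d : ℕ) (hdd : f.natDegree ≤ d)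
    (hc : ∀ i, |f.coeff i| ≤ H) : ∃ (D : ℕ) (A B : ℤ[X]), D ≠ 0 ∧
      (D : ℤ) ≤ (Nat.factorial (d + d) : ℤ) * (d * H) ^ (d + d) ∧
      A * f + B * derivative f = C (D : ℤ) := by
  have hprim := hf.isPrimitive hd.ne'
  have hi := (IsPrimitive.Int.irreducible_iff_irreducible_map_cast hprim).mp hf
  have hsep := hi.separable
  have hne : resultant f (derivative f) ≠ 0 := by
    apply kg_res_ne
    rw [← derivative_map]
    exact hsep
  have hd1 : (1 : ℤ) ≤ d := by exact_mod_cast (by omega : 1 ≤ d)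
  have hM1 : 1 ≤ (d : ℤ) * H := by nlinarith
  have hb := kg_res_bound f (derivative f) f.natDegree (derivative f).natDegree 1 (d * H) (by norm_num)
    (by linarith) (by
      intro i; rw [one_pow, mul_one]; exact (hc i).trans (by nlinarith)) (by
      intro i
      rw [one_pow, mul_one, coeff_derivative, abs_mul]
      by_cases h : i + 1 ≤ f.natDegree
      · have h1 : |((i : ℤ) + 1)| ≤ d := by
          rw [abs_of_nonneg (by positivity)]; exact_mod_cast h.trans hdd
        calc _ ≤ H * d := mul_le_mul (hc _) h1 (abs_nonneg _) (by linarith)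
          _ = _ := mul_comm _ _
      · rw [coeff_eq_zero_of_natDegree_lt (by omega)]
        simp; linarith)
  rw [one_pow, mul_one] at hb
  have hle : f.natDegree + (derivative f).natDegree ≤ d + d := by
    have := natDegree_derivative_le f
    omega
  have hb2 : |resultant f (derivative f)| ≤ (Nat.factorial (d + d) : ℤ) * (d * H) ^ (d + d) := by
    refine hb.trans (mul_le_mul ?_ (pow_le_pow_right₀ hM1 hle) (by positivity) (by positivity))
    exact_mod_cast Nat.factorial_le hle
  obtain ⟨p, g, -, -, hpq⟩ := exists_mul_add_mul_eq_C_resultant f (derivative f) le_rfl le_rfl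
    (Or.inl hd.ne')
  refine ⟨(resultant f (derivative f)).natAbs, ?_⟩
  rcases le_total 0 (resultant f (derivative f)) with h | h
  · refine ⟨p, g, Int.natAbs_ne_zero.mpr hne, ?_, ?_⟩
    · rwa [Int.natCast_natAbs]
    · rw [Int.natCast_natAbs, abs_of_nonneg h, ← hpq]; ring
  · refine ⟨-p, -g, Int.natAbs_ne_zero.mpr hne, ?_, ?_⟩
    · rwa [Int.natCast_natAbs]
    · rw [Int.natCast_natAbs, abs_of_nonpos h, C_neg, ← hpq]; ring


def kgK1 (r : ℕ) : ℕ := 2 * r * (2 * r) * 2 ^ (2 * r)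
def kgC1 (r : ℕ) : ℕ := Nat.factorial (4 * r) * kgK1 r ^ (4 * r)

lemma kgK1_pos {r : ℕ} (hr : 2 ≤ r) : 1 ≤ kgK1 r := by
  unfold kgK1
  have : 0 < r := by omega
  exact Nat.succ_le_of_lt (by positivity)

lemma kgP_coeff' {r s : ℕ} (hr : 2 ≤ r) (hs : s ≤ 2 * r) (c y : Fin s → ℤ) (V : ℤ) (hV : 0 ≤ V)
    (hy : ∀ j, |y j| ≤ V) (hc : ∀ j, |c j| ≤ 2 * r) (i : ℕ) :
    |(kgP c y).coeff i| * V ^ i ≤ (kgK1 r : ℤ) * V ^ (s - 1) := by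
  refine (kgP_coeff c y V (2 * r) hV hy hc i).trans ?_
  apply mul_le_mul_of_nonneg_right _ (by positivity)
  unfold kgK1
  push_cast
  have h1 : (s : ℤ) ≤ 2 * r := by exact_mod_cast hs
  have h2 : (2 : ℤ) ^ (s - 1) ≤ 2 ^ (2 * r) := pow_le_pow_right₀ (by norm_num) (by omega)
  gcongr

lemma kg_noncoprime {r s q : ℕ} (hr : 2 ≤ r) (hs : s ≤ 2 * r) (hs2 : 2 ≤ s) (c y w : Fin s → ℤ)
    (V lam : ℤ) (hV : 1 ≤ V) (hc : ∀ j, |c j| ≤ 2 * r) (hc0 : ∑ k, c k = 0)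
    (hq : (kgC1 r : ℤ) * V ^ (4 * r * (r - 1)) < q)
    (hy : ∀ j, |y j| ≤ V) (hw : ∀ j, |w j| ≤ V)
    (hPw : kgP c w ≠ 0)
    (hyq : (q : ℤ) ∣ (kgP c y).eval lam) (hwq : (q : ℤ) ∣ (kgP c w).eval lam) :
    ¬ IsCoprime ((kgP c w).map (Int.castRingHom ℚ)) ((kgP c y).map (Int.castRingHom ℚ)) := by
  intro hcop
  have hne := kg_res_ne _ _ hcop
  have hmw := kgP_natDegree c w hc0
  have hmy := kgP_natDegree c y hc0
  have hbw := kgP_coeff' hr hs c w V (by linarith) hw hc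
  have hby := kgP_coeff' hr hs c y V (by linarith) hy hc
  have hK1 : (1 : ℤ) ≤ kgK1 r := by exact_mod_cast kgK1_pos hr
  have hC1 : (kgK1 r : ℤ) ≤ kgC1 r := by
    have : kgK1 r ≤ kgC1 r := by
      unfold kgC1
      calc kgK1 r = 1 * kgK1 r ^ 1 := by simp
        _ ≤ _ := Nat.mul_le_mul (Nat.succ_le_of_lt (Nat.factorial_pos _))
            (Nat.pow_le_pow_right (kgK1_pos hr) (by omega))
    exact_mod_cast this
  obtain ⟨t, rfl⟩ : ∃ t, r = t + 2 := ⟨r - 2, by omega⟩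
  obtain ⟨u, rfl⟩ : ∃ u, s = u + 2 := ⟨s - 2, by omega⟩
  simp only [show u + 2 - 1 = u + 1 by omega, show u + 1 - 1 = u by omega,
    show t + 2 - 1 = t + 1 by omega] at *
  by_cases h0 : (kgP c w).natDegree = 0 ∧ (kgP c y).natDegree = 0
  · obtain ⟨a, ha⟩ := natDegree_eq_zero.mp h0.1
    rw [← ha, eval_C] at hwq
    have ha0 : a ≠ 0 := by rintro rfl; apply hPw; rw [← ha]; simp
    have h1 := hbw 0
    rw [← ha, coeff_C_zero, pow_zero, mul_one] at h1
    have h2 := Int.le_of_dvd (abs_pos.mpr ha0) ((dvd_abs _ _).mpr hwq)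
    have h3 : V ^ (u + 1) ≤ V ^ (4 * (t + 2) * (t + 1)) := pow_le_pow_right₀ hV (by nlinarith)
    have h4 : (kgK1 (t + 2) : ℤ) * V ^ (u + 1) ≤ kgC1 (t + 2) * V ^ (4 * (t + 2) * (t + 1)) :=
      mul_le_mul hC1 h3 (by positivity) (by positivity)
    linarith
  · have hdiv : (q : ℤ) ∣ resultant (kgP c w) (kgP c y) := by
      obtain ⟨p, g, -, -, hpg⟩ := exists_mul_add_mul_eq_C_resultant (kgP c w) (kgP c y) le_rfl le_rfl
        (by omega)
      have := congrArg (eval lam) hpg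
      rw [eval_C, eval_add, eval_mul, eval_mul] at this
      rw [← this]
      exact dvd_add (hwq.mul_right _) (hyq.mul_right _)
    have h2 := Int.le_of_dvd (abs_pos.mpr hne) ((dvd_abs _ _).mpr hdiv)
    have h3 := kg_res_bound (kgP c w) (kgP c y) (kgP c w).natDegree (kgP c y).natDegree V _
      (by linarith) (by positivity) hbw hby
    generalize (kgP c w).natDegree = m at *
    generalize (kgP c y).natDegree = n at *
    have h4 : (Nat.factorial (m + n) : ℤ) * (kgK1 (t + 2) : ℤ) ^ (m + n) ≤ kgC1 (t + 2) := by
      have : Nat.factorial (m + n) * kgK1 (t + 2) ^ (m + n) ≤ kgC1 (t + 2) := by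
        unfold kgC1
        exact Nat.mul_le_mul (Nat.factorial_le (by omega))
            (Nat.pow_le_pow_right (kgK1_pos hr) (by omega))
      exact_mod_cast this
    have h5 : (u + 1) * (m + n) ≤ m * n + 4 * (t + 2) * (t + 1) := by
      obtain ⟨a, ha⟩ := Nat.exists_eq_add_of_le hmw
      obtain ⟨b, hb⟩ := Nat.exists_eq_add_of_le hmy
      have h6 : (u + 1) * (m + n) ≤ m * n + (u + 2) * u := by
        have ha' : (u : ℤ) = m + a := by exact_mod_cast ha
        have hb' : (u : ℤ) = n + b := by exact_mod_cast hb
        zify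
        rw [show (m : ℤ) = u - a by linarith, show (n : ℤ) = u - b by linarith]
        nlinarith [mul_nonneg (Int.natCast_nonneg a) (Int.natCast_nonneg b)]
      nlinarith
    have h6 : V ^ ((u + 1) * (m + n)) ≤ V ^ (m * n) * V ^ (4 * (t + 2) * (t + 1)) := by
      rw [← pow_add]; exact pow_le_pow_right₀ hV h5
    have h7 : (Nat.factorial (m + n) : ℤ) * ((kgK1 (t + 2) : ℤ) * V ^ (u + 1)) ^ (m + n) ≤
        kgC1 (t + 2) * (V ^ (m * n) * V ^ (4 * (t + 2) * (t + 1))) := by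
      rw [mul_pow, ← pow_mul, ← mul_assoc]
      exact mul_le_mul h4 h6 (by positivity) (by positivity)
    have h8 : |resultant (kgP c w) (kgP c y) m n| * V ^ (m * n) ≤
        (kgC1 (t + 2) * V ^ (4 * (t + 2) * (t + 1))) * V ^ (m * n) := by
      refine h3.trans (h7.trans (le_of_eq (by ring)))
    have h9 := le_of_mul_le_mul_right h8 (by positivity)
    linarith

def kgC2 (r : ℕ) : ℕ := (Nat.factorial (4 * r) *
    (2 * r * (2 ^ (2 * r) * ((2 * r + 1) * kgK1 r))) ^ (4 * r)) * (2 * r) ^ (2 * r) + 2 * r * 2 ^ (2 * r)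

lemma kgP_self_bound {s : ℕ} (c y : Fin s → ℤ) (V R : ℤ) (hy : ∀ j, |y j| ≤ V)
    (hc : ∀ j, |c j| ≤ R) (k : Fin s) :
    |(kgP c y).eval (y k)| ≤ R * (2 * V) ^ (s - 1) := by
  rw [kgP_eval_self, abs_mul, Finset.abs_prod]
  have h1 : ∏ j ∈ Finset.univ.erase k, |y k - y j| ≤ ∏ j ∈ Finset.univ.erase k, (2 * V) := by
    apply Finset.prod_le_prod (fun _ _ => abs_nonneg _)
    intro j _
    calc |y k - y j| ≤ |y k| + |y j| := abs_sub _ _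
      _ ≤ 2 * V := by linarith [hy k, hy j]
  rw [Finset.prod_const, Finset.card_erase_of_mem (Finset.mem_univ k), Finset.card_univ,
    Fintype.card_fin] at h1
  exact mul_le_mul (hc k) h1 (Finset.prod_nonneg fun _ _ => abs_nonneg _) ((abs_nonneg _).trans (hc k))

lemma kg_good_factor {r s : ℕ} (hr : 2 ≤ r) (hs : s ≤ 2 * r) (hs2 : 2 ≤ s) (c w : Fin s → ℤ)
    (V : ℕ) (hV : 1 ≤ V) (hc : ∀ j, |c j| ≤ 2 * r) (hcn : ∀ j, c j ≠ 0) (hc0 : ∑ k, c k = 0)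
    (hw : ∀ j, |w j| ≤ V) (hPw : kgP c w ≠ 0) (f : ℤ[X]) (hf : Irreducible f) (hd : 0 < f.natDegree)
    (hfd : f ∣ kgP c w) :
    f.natDegree ≤ 2 * r ∧ ∃ (D : ℕ) (A B : ℤ[X]), D ≠ 0 ∧ D ≤ kgC2 r * V ^ (8 * r * r) ∧
      A * f + B * derivative f = C (D : ℤ) ∧ ∀ k, c k ∣ (D : ℤ) := by
  have hV' : (1 : ℤ) ≤ V := by exact_mod_cast hV
  have hmw := kgP_natDegree c w hc0
  have hK1 : (1 : ℤ) ≤ kgK1 r := by exact_mod_cast kgK1_pos hr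
  have hM : ∀ i, |(kgP c w).coeff i| ≤ kgK1 r * (V : ℤ) ^ (2 * r) := by
    intro i
    have h1 := kgP_coeff' hr hs c w V (by linarith) hw hc i
    calc |(kgP c w).coeff i| ≤ |(kgP c w).coeff i| * (V : ℤ) ^ i :=
          le_mul_of_one_le_right (abs_nonneg _) (one_le_pow₀ hV')
      _ ≤ _ := h1
      _ ≤ _ := by gcongr; omega
  obtain ⟨h, hh⟩ := hfd
  have hdle : f.natDegree ≤ 2 * r := by
    have := natDegree_le_of_dvd (Dvd.intro _ hh.symm) hPw
    omega
  refine ⟨hdle, ?_⟩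
  have hP2 := hPw
  rw [hh] at hPw hM hmw
  have hcoef : ∀ i, |f.coeff i| ≤ 2 ^ (2 * r) * ((2 * r + 1) * (kgK1 r * (V : ℤ) ^ (2 * r))) := by
    intro i
    refine (kg_mignotte f h hPw _ hM i).trans ?_
    have h1 : (((f * h).natDegree + 1 : ℕ) : ℤ) ≤ 2 * r + 1 := by
      have : (f * h).natDegree + 1 ≤ 2 * r + 1 := by omega
      exact_mod_cast this
    have h2 : (2 : ℤ) ^ (f * h).natDegree ≤ 2 ^ (2 * r) := pow_le_pow_right₀ (by norm_num) (by omega)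
    gcongr
  obtain ⟨D, A, B, hD0, hDle, hAB⟩ := kg_disc f hf hd _ (by
    have h1 : (1 : ℤ) ≤ 2 ^ (2 * r) := one_le_pow₀ (by norm_num)
    have h2 : (1 : ℤ) ≤ V ^ (2 * r) := one_le_pow₀ hV'
    have h3 : (1 : ℤ) ≤ 2 * r + 1 := by linarith [Int.natCast_nonneg r]
    exact one_le_mul_of_one_le_of_one_le h1 (one_le_mul_of_one_le_of_one_le h3
      (one_le_mul_of_one_le_of_one_le hK1 h2))) (2 * r) hdle hcoef
  set E : ℕ := ∏ k, (c k).natAbs with hE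
  refine ⟨D * E, C (E : ℤ) * A, C (E : ℤ) * B, ?_, ?_, ?_, ?_⟩
  · refine mul_ne_zero hD0 (Finset.prod_ne_zero_iff.mpr fun k _ => by simpa using hcn k)
  · have hEle : E ≤ (2 * r) ^ (2 * r) := by
      calc E ≤ ∏ k : Fin s, 2 * r := Finset.prod_le_prod' (fun k _ => by have := hc k; zify; exact this)
        _ = (2 * r) ^ s := by simp
        _ ≤ _ := Nat.pow_le_pow_right (by omega) hs
    have hD' : D ≤ Nat.factorial (4 * r) *
      (2 * r * (2 ^ (2 * r) * ((2 * r + 1) * (kgK1 r * V ^ (2 * r))))) ^ (4 * r) := by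
      have h44 : 2 * r + 2 * r = 4 * r := by ring
      rw [h44] at hDle
      exact_mod_cast hDle
    calc D * E ≤ _ := Nat.mul_le_mul hD' hEle
      _ = ((Nat.factorial (4 * r) *
    (2 * r * (2 ^ (2 * r) * ((2 * r + 1) * kgK1 r))) ^ (4 * r)) * (2 * r) ^ (2 * r)) * V ^ (8 * r * r) := by
          rw [show 8 * r * r = (2 * r) * (4 * r) by ring, pow_mul V (2 * r) (4 * r)]
          rw [show 2 * r * (2 ^ (2 * r) * ((2 * r + 1) * (kgK1 r * V ^ (2 * r)))) =
            (2 * r * (2 ^ (2 * r) * ((2 * r + 1) * kgK1 r))) * V ^ (2 * r) by ring]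
          rw [mul_pow _ (V ^ (2 * r)) (4 * r)]
          generalize (V ^ (2 * r)) ^ (4 * r) = a
          generalize (2 * r * (2 ^ (2 * r) * ((2 * r + 1) * kgK1 r))) ^ (4 * r) = b
          generalize (2 * r) ^ (2 * r) = e
          ring
      _ ≤ _ := by
          unfold kgC2
          exact Nat.mul_le_mul_right _ (Nat.le_add_right _ _)
  · rw [mul_assoc, mul_assoc, ← mul_add, hAB, ← C_mul, mul_comm]; push_cast; rfl
  · intro k
    have h1 : (c k).natAbs ∣ E := Finset.dvd_prod_of_mem _ (Finset.mem_univ k)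
    rw [← Int.natAbs_dvd]
    exact_mod_cast h1.mul_left D

lemma kg_good (r s : ℕ) (hr : 2 ≤ r) (hs : s ≤ 2 * r) (δ : ℝ) (hδ : 0 < δ) :
    ∃ K : ℝ, 1 ≤ K ∧ ∀ (c : Fin s → ℤ) (q V : ℕ) (lam : ℤ) (G : Finset (Fin s → ℤ)),
      (∀ j, |c j| ≤ 2 * r) → (∀ j, c j ≠ 0) → ∑ k, c k = 0 → 1 ≤ V →
      kgC1 r * V ^ (4 * r * (r - 1)) < q →
      (∀ y ∈ G, Function.Injective y ∧ (∀ j, |y j| ≤ V) ∧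
        (∀ k, IsUnit (((lam - y k : ℤ)) : ZMod q)) ∧
        ∑ k, ((c k : ℤ) : ZMod q) * (((lam - y k : ℤ)) : ZMod q)⁻¹ = 0) →
      (G.card : ℝ) ≤ K * (q : ℝ) ^ δ * √(V : ℝ) ^ s := by
  classical
  have hr0 : (0 : ℝ) < 8 * r * r := by
    have : (0 : ℝ) < r := by exact_mod_cast (by omega : 0 < r)
    positivity
  obtain ⟨K, hK1, hK⟩ := kg_count (2 * r) s (δ / (8 * r * r)) (div_pos hδ hr0)
  have hC2 : (1 : ℝ) ≤ kgC2 r := by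
    have : 1 ≤ kgC2 r := by
      unfold kgC2
      have : 0 < r := by omega
      have : 0 < 2 * r * 2 ^ (2 * r) := by positivity
      omega
    exact_mod_cast this
  have hC3 : (1 : ℝ) ≤ (kgC2 r : ℝ) ^ (δ / (8 * r * r)) :=
    Real.one_le_rpow hC2 (div_pos hδ hr0).le
  have hr1 : (1 : ℝ) ≤ 2 * r := by exact_mod_cast (by omega : 1 ≤ 2 * r)
  refine ⟨(2 * r) * (K * (kgC2 r : ℝ) ^ (δ / (8 * r * r))),
    one_le_mul_of_one_le_of_one_le hr1 (one_le_mul_of_one_le_of_one_le hK1 hC3), ?_⟩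
  intro c q V lam G hc hcn hc0 hV hq hG
  have hV' : (1 : ℤ) ≤ V := by exact_mod_cast hV
  have hVr : (1 : ℝ) ≤ V := by exact_mod_cast hV
  have hq1 : (1 : ℝ) ≤ q := by exact_mod_cast (by omega : 1 ≤ q)
  have hqd : (1 : ℝ) ≤ (q : ℝ) ^ δ := Real.one_le_rpow hq1 hδ.le
  have hVs : (1 : ℝ) ≤ √(V : ℝ) ^ s := one_le_pow₀ (Real.one_le_sqrt.mpr hVr)
  have hone : (1 : ℝ) ≤ (2 * r) * (K * (kgC2 r : ℝ) ^ (δ / (8 * r * r))) * (q : ℝ) ^ δ * √(V : ℝ) ^ s :=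
    one_le_mul_of_one_le_of_one_le (one_le_mul_of_one_le_of_one_le
      (one_le_mul_of_one_le_of_one_le hr1 (one_le_mul_of_one_le_of_one_le hK1 hC3)) hqd) hVs
  rcases Nat.lt_or_ge s 2 with hs2 | hs2
  · interval_cases s
    · refine le_trans ?_ hone
      have : G.card ≤ 1 := Finset.card_le_one.mpr (fun a _ b _ => Subsingleton.elim a b)
      exact_mod_cast this
    · exact absurd (by simpa using hc0) (hcn 0)
  rcases G.eq_empty_or_nonempty with rfl | ⟨w, hwG⟩
  · refine le_trans ?_ hone
    simp
  have hPne : ∀ y ∈ G, ∀ k, (kgP c y).eval (y k) ≠ 0 := by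
    intro y hy k
    rw [kgP_eval_self]
    refine mul_ne_zero (hcn k) (Finset.prod_ne_zero_iff.mpr fun j hj => ?_)
    rw [sub_ne_zero]
    intro h
    exact (Finset.mem_erase.mp hj).1 ((hG y hy).1 h).symm
  have hPw : kgP c w ≠ 0 := by
    intro h
    have := hPne w hwG ⟨0, by omega⟩
    rw [h] at this
    simp at this
  obtain ⟨F, hFcard, hFirr, hFE⟩ := kg_factors _ hPw
  have hqz : (kgC1 r : ℤ) * (V : ℤ) ^ (4 * r * (r - 1)) < q := by exact_mod_cast hq
  have hcover : G ⊆ F.biUnion (fun f => G.filter (fun y => f ∣ kgP c y)) := by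
    intro y hy
    obtain ⟨f, hf, hfd⟩ := hFE (kgP c y) (kg_noncoprime hr hs hs2 c y w V lam hV' hc hc0 hqz
      (hG y hy).2.1 (hG w hwG).2.1 hPw (kgP_eval_zmod c y lam (hG y hy).2.2.1 (hG y hy).2.2.2)
      (kgP_eval_zmod c w lam (hG w hwG).2.2.1 (hG w hwG).2.2.2))
    exact Finset.mem_biUnion.mpr ⟨f, hf, Finset.mem_filter.mpr ⟨hy, hfd⟩⟩
  have hQ : ((kgC2 r * V ^ (8 * r * r) : ℕ) : ℝ) ^ (δ / (8 * r * r)) ≤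
      (kgC2 r : ℝ) ^ (δ / (8 * r * r)) * (q : ℝ) ^ δ := by
    push_cast
    rw [Real.mul_rpow (by positivity) (by positivity)]
    gcongr
    rw [← Real.rpow_natCast, ← Real.rpow_mul (by positivity)]
    have : ((8 * r * r : ℕ) : ℝ) * (δ / (8 * r * r)) = δ := by
      push_cast; field_simp
    rw [this]
    apply Real.rpow_le_rpow (by positivity) _ hδ.le
    have h1 : V ≤ q := by
      have h2 : V ^ 1 ≤ V ^ (4 * r * (r - 1)) := Nat.pow_le_pow_right hV (by
        have : 1 ≤ r - 1 := by omega
        nlinarith)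
      have h3 : 1 ≤ kgC1 r := Nat.mul_pos (Nat.factorial_pos _) (pow_pos (kgK1_pos hr) _)
      nlinarith
    exact_mod_cast h1
  have hone_f : ∀ f ∈ F, ((G.filter (fun y => f ∣ kgP c y)).card : ℝ) ≤
      K * ((kgC2 r : ℝ) ^ (δ / (8 * r * r)) * (q : ℝ) ^ δ) * √(V : ℝ) ^ s := by
    intro f hf
    obtain ⟨hirr, hd, hfd⟩ := hFirr f hf
    obtain ⟨hdle, D, A, B, hD0, hDle, hAB, hcD⟩ := kg_good_factor hr hs hs2 c w V hV hc hcn hc0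
      (hG w hwG).2.1 hPw f hirr hd hfd
    have := hK f D V (kgC2 r * V ^ (8 * r * r)) A B c (G.filter (fun y => f ∣ kgP c y)) hd hdle hD0
      hDle hV hAB hcD (by
        intro y hy k
        rw [Finset.mem_filter] at hy
        have hdv : f.eval (y k) ∣ (kgP c y).eval (y k) := eval_dvd hy.2
        have hle := Int.le_of_dvd (abs_pos.mpr (hPne y hy.1 k)) ((abs_dvd_abs _ _).mpr hdv)
        refine ⟨abs_le.mp ((hG y hy.1).2.1 k), ?_, ?_, ?_⟩
        · have h1 := hle.trans (kgP_self_bound c y V (2 * r) (hG y hy.1).2.1 hc k)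
          have h2 : (f.eval (y k)).natAbs ≤ 2 * r * (2 * V) ^ (s - 1) := by
            zify; exact h1
          refine h2.trans ?_
          rw [mul_pow, ← mul_assoc]
          refine Nat.mul_le_mul ?_ (Nat.pow_le_pow_right hV (by nlinarith [Nat.sub_le s 1]))
          unfold kgC2
          refine le_trans ?_ (Nat.le_add_left _ _)
          exact Nat.mul_le_mul_left _ (Nat.pow_le_pow_right (by norm_num) (by omega))
        · intro h0
          rw [h0, zero_dvd_iff] at hdv
          exact hPne y hy.1 k hdv
        · rw [← kgP_eval_self]; exact hdv)
    refine this.trans ?_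
    gcongr
  have hFr : (F.card : ℝ) ≤ 2 * r := by
    have := kgP_natDegree c w hc0
    exact_mod_cast (by omega : F.card ≤ 2 * r)
  calc (G.card : ℝ) ≤ ((F.biUnion (fun f => G.filter (fun y => f ∣ kgP c y))).card : ℝ) := by
        exact_mod_cast Finset.card_le_card hcover
    _ ≤ ∑ f ∈ F, ((G.filter (fun y => f ∣ kgP c y)).card : ℝ) := by
        exact_mod_cast Finset.card_biUnion_le
    _ ≤ ∑ f ∈ F, K * ((kgC2 r : ℝ) ^ (δ / (8 * r * r)) * (q : ℝ) ^ δ) * √(V : ℝ) ^ s :=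
        Finset.sum_le_sum hone_f
    _ = F.card * (K * ((kgC2 r : ℝ) ^ (δ / (8 * r * r)) * (q : ℝ) ^ δ) * √(V : ℝ) ^ s) := by simp
    _ ≤ (2 * r) * (K * ((kgC2 r : ℝ) ^ (δ / (8 * r * r)) * (q : ℝ) ^ δ) * √(V : ℝ) ^ s) := by
        gcongr
    _ = _ := by ring

end


lemma kg_encode {n : ℕ} (v sg : Fin n → ℤ) (hsg : ∀ i, sg i ≠ 0) :
    ∃ (s z : ℕ) (π : Fin n → Fin s ⊕ Fin z) (y : Fin s → ℤ) (e : Fin z → ℤ),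
      s + 2 * z ≤ n ∧ Function.Injective y ∧ (∀ i, v i = Sum.elim y e (π i)) ∧
      (∀ k, ∑ i with π i = Sum.inl k, sg i ≠ 0) ∧ (∀ k, ∑ i with π i = Sum.inr k, sg i = 0) ∧
      (∀ x, ∃ i, π i = x) := by
  classical
  set T := Finset.univ.image v with hT
  set U := T.filter (fun u => ∑ i with v i = u, sg i ≠ 0) with hU
  set Z := T.filter (fun u => ¬ ∑ i with v i = u, sg i ≠ 0) with hZ
  have hmem : ∀ i, v i ∉ U → v i ∈ Z := by
    intro i hi
    rw [hU, Finset.mem_filter, not_and] at hi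
    rw [hZ, Finset.mem_filter]
    have : v i ∈ T := Finset.mem_image_of_mem _ (Finset.mem_univ i)
    exact ⟨this, hi this⟩
  set π : Fin n → Fin U.card ⊕ Fin Z.card := fun i =>
    if h : v i ∈ U then Sum.inl (U.equivFin ⟨v i, h⟩) else Sum.inr (Z.equivFin ⟨v i, hmem i h⟩) with hπ
  set y : Fin U.card → ℤ := fun k => (U.equivFin.symm k).1 with hy
  set e : Fin Z.card → ℤ := fun k => (Z.equivFin.symm k).1 with he
  have hyU : ∀ k, y k ∈ U := fun k => (U.equivFin.symm k).2
  have heZ : ∀ k, e k ∈ Z := fun k => (Z.equivFin.symm k).2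
  have hdisj : ∀ u, u ∈ U → u ∈ Z → False := by
    intro u h1 h2
    exact (Finset.mem_filter.mp h2).2 (Finset.mem_filter.mp h1).2
  have hfl : ∀ i k, π i = Sum.inl k ↔ v i = y k := by
    intro i k
    simp only [hπ, hy]
    constructor
    · intro h
      split_ifs at h with h1
      rw [← Sum.inl.inj h]; simp
    · intro h
      have h1 : v i ∈ U := h ▸ hyU k
      rw [dif_pos h1]
      congr 1
      rw [← Equiv.eq_symm_apply]
      exact Subtype.ext h
  have hfr : ∀ i k, π i = Sum.inr k ↔ v i = e k := by
    intro i k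
    simp only [hπ, he]
    constructor
    · intro h
      split_ifs at h with h1
      rw [← Sum.inr.inj h]; simp
    · intro h
      have h1 : v i ∉ U := fun h2 => hdisj _ h2 (h ▸ heZ k)
      rw [dif_neg h1]
      congr 1
      rw [← Equiv.eq_symm_apply]
      exact Subtype.ext h
  have hl : ∀ k, ∑ i with π i = Sum.inl k, sg i ≠ 0 := by
    intro k
    simp only [hfl]
    exact (Finset.mem_filter.mp (hyU k)).2
  have hr : ∀ k, ∑ i with π i = Sum.inr k, sg i = 0 := by
    intro k
    simp only [hfr]
    exact not_not.mp (Finset.mem_filter.mp (heZ k)).2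
  have hsurj : ∀ x, ∃ i, π i = x := by
    rintro (k | k)
    · obtain ⟨i, -, hi⟩ := Finset.mem_image.mp (Finset.mem_filter.mp (hyU k)).1
      exact ⟨i, (hfl i k).mpr hi⟩
    · obtain ⟨i, -, hi⟩ := Finset.mem_image.mp (Finset.mem_filter.mp (heZ k)).1
      exact ⟨i, (hfr i k).mpr hi⟩
  refine ⟨U.card, Z.card, π, y, e, ?_, ?_, ?_, hl, hr, hsurj⟩
  · have h1 : n = ∑ x, (Finset.univ.filter (fun i => π i = x)).card := by
      have := Finset.card_eq_sum_card_fiberwise (f := π) (s := Finset.univ) (t := Finset.univ)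
        (fun _ _ => Finset.mem_coe.mpr (Finset.mem_univ _))
      simpa using this
    rw [Fintype.sum_sum_type] at h1
    have h2 : ∑ _k : Fin U.card, 1 ≤ ∑ k : Fin U.card, (Finset.univ.filter (fun i => π i = Sum.inl k)).card := by
      apply Finset.sum_le_sum
      intro k _
      obtain ⟨i, hi⟩ := hsurj (Sum.inl k)
      exact Finset.card_pos.mpr ⟨i, by simp [hi]⟩
    have h3 : ∑ _k : Fin Z.card, 2 ≤ ∑ k : Fin Z.card, (Finset.univ.filter (fun i => π i = Sum.inr k)).card := by
      apply Finset.sum_le_sum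
      intro k _
      obtain ⟨i, hi⟩ := hsurj (Sum.inr k)
      by_contra hlt
      have hc1 : (Finset.univ.filter (fun i => π i = Sum.inr k)).card = 1 := by
        have : 0 < (Finset.univ.filter (fun i => π i = Sum.inr k)).card :=
          Finset.card_pos.mpr ⟨i, by simp [hi]⟩
        omega
      obtain ⟨j, hj⟩ := Finset.card_eq_one.mp hc1
      have := hr k
      rw [hj, Finset.sum_singleton] at this
      exact hsg j this
    simp at h2 h3
    omega
  · intro a b hab
    exact U.equivFin.symm.injective (Subtype.ext hab)
  · intro i
    rcases h : π i with k | k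
    · exact (hfl i k).mp h
    · exact (hfr i k).mp h

def kgsg (r : ℕ) (i : Fin (r + r)) : ℤ := Fin.addCases (fun _ => 1) (fun _ => -1) i

lemma kgsg_left (r : ℕ) (i : Fin r) : kgsg r (Fin.castAdd r i) = 1 := by simp [kgsg]
lemma kgsg_right (r : ℕ) (i : Fin r) : kgsg r (Fin.natAdd r i) = -1 := by
  rw [kgsg, Fin.addCases_right]
lemma kgsg_abs (r : ℕ) (i : Fin (r + r)) : |kgsg r i| = 1 := by
  refine Fin.addCases (fun j => ?_) (fun j => ?_) i
  · rw [kgsg_left]; simp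
  · rw [kgsg_right]; simp
lemma kgsg_sum (r : ℕ) : ∑ i, kgsg r i = 0 := by
  rw [Fin.sum_univ_add]; simp only [kgsg_left, kgsg_right]; simp

def kgc (r : ℕ) {s z : ℕ} (π : Fin (r + r) → Fin s ⊕ Fin z) (k : Fin s) : ℤ :=
  ∑ i with π i = Sum.inl k, kgsg r i

lemma kgc_abs (r : ℕ) {s z : ℕ} (π : Fin (r + r) → Fin s ⊕ Fin z) (k : Fin s) : |kgc r π k| ≤ 2 * r := by
  unfold kgc
  refine (Finset.abs_sum_le_sum_abs _ _).trans ?_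
  simp only [kgsg_abs]
  rw [Finset.sum_const, nsmul_eq_mul, mul_one]
  have := Finset.card_le_univ (Finset.univ.filter (fun i => π i = Sum.inl k))
  rw [Fintype.card_fin] at this
  push_cast [← two_mul] at this ⊢
  exact_mod_cast this.trans (by omega)

/-- Fiberwise evaluation of a signed sum. -/
lemma kg_signed_sum {R : Type*} [CommRing R] (r : ℕ) {s z : ℕ} (π : Fin (r + r) → Fin s ⊕ Fin z)
    (hz : ∀ k, ∑ i with π i = Sum.inr k, kgsg r i = 0) (g : Fin s ⊕ Fin z → R) :
    ∑ i, (kgsg r i : R) * g (π i) = ∑ k, (kgc r π k : R) * g (Sum.inl k) := by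
  classical
  rw [← Finset.sum_fiberwise Finset.univ π, Fintype.sum_sum_type]
  have h1 : ∀ x, ∑ i with π i = x, (kgsg r i : R) * g (π i) = ((∑ i with π i = x, kgsg r i : ℤ) : R) * g x := by
    intro x
    rw [Int.cast_sum, Finset.sum_mul]
    apply Finset.sum_congr rfl
    intro i hi
    rw [(Finset.mem_filter.mp hi).2]
  simp only [h1, hz]
  simp [kgc]

lemma kg_cond {r q : ℕ} (lam : ℤ) (v : Fin (r + r) → ℤ)
    (h : ∑ i : Fin r, (((lam + v (Fin.castAdd r i) : ℤ) : ZMod q))⁻¹ =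
        ∑ i : Fin r, (((lam + v (Fin.natAdd r i) : ℤ) : ZMod q))⁻¹) :
    ∑ i, ((kgsg r i : ℤ) : ZMod q) * (((lam + v i : ℤ) : ZMod q))⁻¹ = 0 := by
  rw [Fin.sum_univ_add]
  simp only [kgsg_left, kgsg_right]
  rw [← Finset.mul_sum, ← Finset.mul_sum, h]
  push_cast
  ring

open scoped Classical in
/-- The set of good enumerations. -/
noncomputable def kgGood (q V : ℕ) (lam : ℤ) {s : ℕ} (c : Fin s → ℤ) : Finset (Fin s → ℤ) :=
  (Fintype.piFinset (fun _ : Fin s => Finset.Icc (-(V : ℤ)) (V : ℤ))).filter (fun y =>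
    Function.Injective y ∧ (∀ k, IsUnit (((lam - y k : ℤ)) : ZMod q)) ∧
        ∑ k, ((c k : ℤ) : ZMod q) * (((lam - y k : ℤ)) : ZMod q)⁻¹ = 0)

open scoped Classical in
/-- The piece of the solution set attached to a pattern. -/
noncomputable def kgPiece (r q V : ℕ) (lam : ℤ) {s z : ℕ} (π : Fin (r + r) → Fin s ⊕ Fin z) :
    Finset (Fin (r + r) → ℤ) :=
  if (∀ k, kgc r π k ≠ 0) ∧ ∑ k, kgc r π k = 0 ∧ s + 2 * z ≤ r + r then
    ((kgGood q V lam (kgc r π)) ×ˢ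
      (Fintype.piFinset (fun _ : Fin z => Finset.Icc (-(V : ℤ)) (V : ℤ)))).image
      (fun p i => Sum.elim (fun k => - p.1 k) p.2 (π i))
  else ∅

lemma kg_pieces (r q V : ℕ) (lam : ℤ) :
    Kcount r q lam V ≤ ∑ s ∈ Finset.range (2 * r + 1), ∑ z ∈ Finset.range (2 * r + 1),
      ∑ π : Fin (r + r) → Fin s ⊕ Fin z, (kgPiece r q V lam π).card := by
  classical
  unfold Kcount
  set S := (Fintype.piFinset (fun _ : Fin (r + r) => Finset.Icc (-(V : ℤ)) (V : ℤ))).filter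
    (fun v : Fin (r + r) → ℤ =>
      (∀ i, IsUnit ((lam + v i : ℤ) : ZMod q)) ∧
      ∑ i : Fin r, (((lam + v (Fin.castAdd r i) : ℤ) : ZMod q))⁻¹ =
        ∑ i : Fin r, (((lam + v (Fin.natAdd r i) : ℤ) : ZMod q))⁻¹) with hS
  have hcov : S ⊆ (Finset.range (2 * r + 1)).biUnion (fun s => (Finset.range (2 * r + 1)).biUnion (fun z =>
      Finset.univ.biUnion (fun π : Fin (r + r) → Fin s ⊕ Fin z => kgPiece r q V lam π))) := by
    intro v hv
    rw [hS, Finset.mem_filter, Fintype.mem_piFinset] at hv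
    obtain ⟨hvV, hunit, heq⟩ := hv
    obtain ⟨s, z, π, y, e, hsz, hinj, hvy, hl, hz, hsurj⟩ := kg_encode v (kgsg r) (fun i h => by
      have := kgsg_abs r i; rw [h] at this; simp at this)
    simp only [Finset.mem_biUnion, Finset.mem_range]
    refine ⟨s, by omega, z, by omega, π, Finset.mem_univ _, ?_⟩
    have hc0 : ∑ k, kgc r π k = 0 := by
      have := kg_signed_sum (R := ℤ) r π hz (fun _ => 1)
      simp only [mul_one, Int.cast_id] at this
      rw [← this, kgsg_sum]
    unfold kgPiece
    rw [if_pos ⟨hl, hc0, hsz⟩, Finset.mem_image]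
    have hyv : ∀ k, ∃ i, v i = y k := by
      intro k
      obtain ⟨i, hi⟩ := hsurj (Sum.inl k)
      exact ⟨i, by rw [hvy i, hi]; rfl⟩
    have hev : ∀ k, ∃ i, v i = e k := by
      intro k
      obtain ⟨i, hi⟩ := hsurj (Sum.inr k)
      exact ⟨i, by rw [hvy i, hi]; rfl⟩
    refine ⟨(fun k => - y k, e), ?_, ?_⟩
    · rw [Finset.mem_product]
      refine ⟨?_, ?_⟩
      · simp only [kgGood, Finset.mem_filter, Fintype.mem_piFinset, sub_neg_eq_add]
        refine ⟨?_, ?_, ?_, ?_⟩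
        · intro k
          obtain ⟨i, hi⟩ := hyv k
          have := Finset.mem_Icc.mp (hvV i)
          rw [← hi, Finset.mem_Icc]
          constructor <;> linarith [this.1, this.2]
        · intro a b hab
          exact hinj (neg_injective hab)
        · intro k
          obtain ⟨i, hi⟩ := hyv k
          rw [← hi]; exact hunit i
        · have h1 := kg_cond lam v heq
          have h2 := kg_signed_sum (R := ZMod q) r π hz
            (fun x => (((lam + Sum.elim y e x : ℤ) : ZMod q))⁻¹)
          simp only [← hvy, Sum.elim_inl] at h2
          rw [← h2]
          exact h1
      · rw [Fintype.mem_piFinset]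
        intro k
        obtain ⟨i, hi⟩ := hev k
        have := hvV i
        rwa [hi] at this
    · funext i
      simp only [neg_neg]
      exact (hvy i).symm
  refine (Finset.card_le_card hcov).trans ?_
  refine Finset.card_biUnion_le.trans (Finset.sum_le_sum fun s _ => ?_)
  refine Finset.card_biUnion_le.trans (Finset.sum_le_sum fun z _ => ?_)
  exact Finset.card_biUnion_le

lemma kg_restricted (r : ℕ) (hr : 2 ≤ r) (δ : ℝ) (hδ : 0 < δ) :
    ∃ K : ℝ, 0 ≤ K ∧ ∀ (q V : ℕ) (lam : ℤ), 1 ≤ V → kgC1 r * V ^ (4 * r * (r - 1)) < q →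
      (Kcount r q lam V : ℝ) ≤ K * (q : ℝ) ^ δ * (V : ℝ) ^ r := by
  classical
  have hgood : ∀ s, ∃ K : ℝ, 1 ≤ K ∧ (s ≤ 2 * r → ∀ (c : Fin s → ℤ) (q V : ℕ) (lam : ℤ) (G : Finset (Fin s → ℤ)),
      (∀ j, |c j| ≤ 2 * r) → (∀ j, c j ≠ 0) → ∑ k, c k = 0 → 1 ≤ V →
      kgC1 r * V ^ (4 * r * (r - 1)) < q →
      (∀ y ∈ G, Function.Injective y ∧ (∀ j, |y j| ≤ V) ∧
        (∀ k, IsUnit (((lam - y k : ℤ)) : ZMod q)) ∧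
        ∑ k, ((c k : ℤ) : ZMod q) * (((lam - y k : ℤ)) : ZMod q)⁻¹ = 0) →
      (G.card : ℝ) ≤ K * (q : ℝ) ^ δ * √(V : ℝ) ^ s) := by
    intro s
    by_cases hs : s ≤ 2 * r
    · obtain ⟨K, h1, h2⟩ := kg_good r s hr hs δ hδ
      exact ⟨K, h1, fun _ => h2⟩
    · exact ⟨1, le_rfl, fun h => absurd h hs⟩
  choose Ks hKs1 hKs using hgood
  refine ⟨∑ s ∈ Finset.range (2 * r + 1), ∑ z ∈ Finset.range (2 * r + 1),
      ∑ _π : Fin (r + r) → Fin s ⊕ Fin z, Ks s * 3 ^ z, ?_, ?_⟩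
  · refine Finset.sum_nonneg fun s _ => Finset.sum_nonneg fun z _ => Finset.sum_nonneg fun π _ => ?_
    have := hKs1 s
    positivity
  · intro q V lam hV hq
    have hVr : (1 : ℝ) ≤ V := by exact_mod_cast hV
    have hmain : (Kcount r q lam V : ℝ) ≤ ∑ s ∈ Finset.range (2 * r + 1), ∑ z ∈ Finset.range (2 * r + 1),
      ∑ π : Fin (r + r) → Fin s ⊕ Fin z, ((kgPiece r q V lam π).card : ℝ) := by
      exact_mod_cast kg_pieces r q V lam
    refine hmain.trans ?_
    rw [mul_assoc]
    simp only [Finset.sum_mul]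
    refine Finset.sum_le_sum fun s hs => Finset.sum_le_sum fun z _ => Finset.sum_le_sum fun π _ => ?_
    have hK1 := hKs1 s
    unfold kgPiece
    split_ifs with hcond
    · obtain ⟨hcn, hc0, hsz⟩ := hcond
      have hg := hKs s (by have := Finset.mem_range.mp hs; omega) (kgc r π) q V lam
        (kgGood q V lam (kgc r π)) (kgc_abs r π) hcn hc0 hV hq (by
          intro y hy
          simp only [kgGood, Finset.mem_filter, Fintype.mem_piFinset] at hy
          refine ⟨hy.2.1, fun j => abs_le.mpr (Finset.mem_Icc.mp (hy.1 j)), hy.2.2.1, hy.2.2.2⟩)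
      have hp : ((Fintype.piFinset (fun _ : Fin z => Finset.Icc (-(V : ℤ)) (V : ℤ))).card : ℝ) ≤ (3 * V) ^ z := by
        rw [Fintype.card_piFinset]
        simp only [Int.card_Icc, Finset.prod_const, Finset.card_univ, Fintype.card_fin]
        have h1 : ((V : ℤ) + 1 - -(V : ℤ)).toNat ≤ 3 * V := by omega
        exact_mod_cast Nat.pow_le_pow_left h1 z
      have hsq : √(V : ℝ) ^ s * (V : ℝ) ^ z ≤ (V : ℝ) ^ r := by
        have h1 : (V : ℝ) = √(V : ℝ) ^ 2 := (Real.sq_sqrt (by positivity)).symm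
        have h2 : (1 : ℝ) ≤ √(V : ℝ) := Real.one_le_sqrt.mpr hVr
        calc √(V : ℝ) ^ s * (V : ℝ) ^ z = √(V : ℝ) ^ (s + 2 * z) := by
              rw [pow_add, pow_mul, ← h1]
          _ ≤ √(V : ℝ) ^ (2 * r) := pow_le_pow_right₀ h2 (by omega)
          _ = (V : ℝ) ^ r := by rw [pow_mul, ← h1]
      have hcard : ((((kgGood q V lam (kgc r π)) ×ˢ
      (Fintype.piFinset (fun _ : Fin z => Finset.Icc (-(V : ℤ)) (V : ℤ)))).image
      (fun (p : (Fin s → ℤ) × (Fin z → ℤ)) i => Sum.elim (fun k => - p.1 k) p.2 (π i))).card : ℝ) ≤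
        (kgGood q V lam (kgc r π)).card * (Fintype.piFinset (fun _ : Fin z => Finset.Icc (-(V : ℤ)) (V : ℤ))).card := by
        have := Finset.card_image_le (s := (kgGood q V lam (kgc r π)) ×ˢ
          (Fintype.piFinset (fun _ : Fin z => Finset.Icc (-(V : ℤ)) (V : ℤ))))
          (f := (fun (p : (Fin s → ℤ) × (Fin z → ℤ)) i => Sum.elim (fun k => - p.1 k) p.2 (π i)))
        rw [Finset.card_product] at this
        exact_mod_cast this
      refine hcard.trans ((mul_le_mul hg hp (by positivity) (by positivity)).trans ?_)
      calc Ks s * (q : ℝ) ^ δ * √(V : ℝ) ^ s * (3 * V) ^ z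
          = Ks s * 3 ^ z * (q : ℝ) ^ δ * (√(V : ℝ) ^ s * (V : ℝ) ^ z) := by rw [mul_pow]; ring
        _ ≤ Ks s * 3 ^ z * (q : ℝ) ^ δ * (V : ℝ) ^ r := by gcongr
        _ = _ := by ring
    · simp
      positivity


open scoped Classical in
/-- The number of solutions of the additive equation with variables in `B`. -/
noncomputable def kgN (r q : ℕ) (x : ℤ → ZMod q) (B : Finset ℤ) : ℕ :=
  ((Fintype.piFinset (fun _ : Fin (r + r) => B)).filter
    (fun v : Fin (r + r) → ℤ => ∑ i : Fin r, x (v (Fin.castAdd r i)) = ∑ i : Fin r, x (v (Fin.natAdd r i)))).card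

lemma kg_addChar_sum {q : ℕ} [NeZero q] (ψ : AddChar (ZMod q) ℂ) {ι : Type*} (s : Finset ι)
    (f : ι → ZMod q) : ψ (∑ i ∈ s, f i) = ∏ i ∈ s, ψ (f i) := by
  classical
  induction s using Finset.induction_on with
  | empty => simp
  | insert a s ha ih => rw [Finset.sum_insert ha, Finset.prod_insert ha, AddChar.map_add_eq_mul, ih]

lemma kgN_char (r q : ℕ) [NeZero q] (x : ℤ → ZMod q) (B : Finset ℤ) :
    (q : ℝ) * kgN r q x B = ∑ a : ZMod q, ‖∑ b ∈ B, ZMod.stdAddChar (a * x b)‖ ^ (2 * r) := by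
  classical
  have key : ((q : ℂ) * kgN r q x B) = ∑ a : ZMod q, ((‖∑ b ∈ B, ZMod.stdAddChar (a * x b)‖ : ℝ) : ℂ) ^ (2 * r) := by
    have h1 : ∀ a : ZMod q, ((‖∑ b ∈ B, ZMod.stdAddChar (a * x b)‖ : ℝ) : ℂ) ^ (2 * r) =
        ∑ v ∈ Fintype.piFinset (fun _ : Fin (r + r) => B),
          (ZMod.stdAddChar (a * (∑ i : Fin r, x (v (Fin.castAdd r i)) - ∑ i : Fin r, x (v (Fin.natAdd r i)))) : ℂ) := by
      intro a
      rw [pow_mul, ← Complex.mul_conj', mul_pow]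
      set g : Fin (r + r) → ℤ → ℂ := fun i b => ZMod.stdAddChar ((kgsg r i : ZMod q) * (a * x b)) with hg
      have h2 := Finset.prod_univ_sum (fun _ : Fin (r + r) => B) g
      have h3 : ∏ i, ∑ b ∈ B, g i b = (∑ b ∈ B, (ZMod.stdAddChar (a * x b) : ℂ)) ^ r *
          (starRingEnd ℂ) (∑ b ∈ B, ZMod.stdAddChar (a * x b)) ^ r := by
        rw [Fin.prod_univ_add]
        congr 1
        · simp only [hg, kgsg_left]
          simp
        · simp only [hg, kgsg_right, map_sum, ← AddChar.map_neg_eq_conj]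
          rw [Finset.prod_const, Finset.card_univ, Fintype.card_fin]
          congr 1
          apply Finset.sum_congr rfl
          intro b _
          congr 1
          push_cast
          ring
      rw [← h3, h2]
      apply Finset.sum_congr rfl
      intro v _
      simp only [hg]
      rw [← kg_addChar_sum]
      congr 1
      rw [Fin.sum_univ_add, mul_sub, Finset.mul_sum, Finset.mul_sum]
      simp only [kgsg_left, kgsg_right]
      rw [sub_eq_add_neg, ← Finset.sum_neg_distrib]
      push_cast
      simp only [one_mul, neg_mul]
    simp only [h1]
    rw [Finset.sum_comm]
    simp only [AddChar.sum_mulShift _ (ZMod.isPrimitive_stdAddChar q), sub_eq_zero, ZMod.card]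
    unfold kgN
    rw [Finset.card_filter]
    push_cast
    rw [Finset.mul_sum]
    apply Finset.sum_congr rfl
    intro v _
    split_ifs <;> simp
  exact_mod_cast key

lemma kgN_holder (r q : ℕ) (hr : 1 ≤ r) [NeZero q] (x : ℤ → ZMod q) (B : Finset ℤ) (M : Finset ℤ) (φ : ℤ → ℤ)
    (hφ : ∀ b ∈ B, φ b ∈ M) (T : ℝ)
    (hT : ∀ m ∈ M, (kgN r q x (B.filter (fun b => φ b = m)) : ℝ) ≤ T) :
    (kgN r q x B : ℝ) ≤ (M.card : ℝ) ^ (2 * r) * T := by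
  have hq : (0 : ℝ) < q := by exact_mod_cast Nat.pos_of_ne_zero (NeZero.ne q)
  have h1 : ∀ a : ZMod q, ‖∑ b ∈ B, (ZMod.stdAddChar (a * x b) : ℂ)‖ ^ (2 * r) ≤
      (M.card : ℝ) ^ (2 * r - 1) * ∑ m ∈ M, ‖∑ b ∈ B with φ b = m, (ZMod.stdAddChar (a * x b) : ℂ)‖ ^ (2 * r) := by
    intro a
    rw [← Finset.sum_fiberwise_of_maps_to hφ]
    obtain ⟨n, hn⟩ : ∃ n, 2 * r = n + 1 := ⟨2 * r - 1, by omega⟩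
    rw [hn, Nat.add_sub_cancel]
    refine (pow_le_pow_left₀ (norm_nonneg _) (norm_sum_le _ _) _).trans ?_
    have h2 := pow_sum_div_card_le_sum_pow (s := M)
      (f := fun m => ‖∑ b ∈ B with φ b = m, (ZMod.stdAddChar (a * x b) : ℂ)‖) (fun _ _ => norm_nonneg _) n
    rcases M.eq_empty_or_nonempty with hM | hM
    · simp [hM]
    · have : (0 : ℝ) < (M.card : ℝ) ^ n := by
        have := Finset.card_pos.mpr hM
        positivity
      rw [div_le_iff₀ this] at h2
      rw [mul_comm]
      exact h2
  have h3 : (q : ℝ) * kgN r q x B ≤ q * ((M.card : ℝ) ^ (2 * r) * T) := by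
    rw [kgN_char]
    calc _ ≤ ∑ a : ZMod q, (M.card : ℝ) ^ (2 * r - 1) *
            ∑ m ∈ M, ‖∑ b ∈ B with φ b = m, (ZMod.stdAddChar (a * x b) : ℂ)‖ ^ (2 * r) :=
          Finset.sum_le_sum fun a _ => h1 a
      _ = (M.card : ℝ) ^ (2 * r - 1) * ∑ m ∈ M, (q : ℝ) * kgN r q x (B.filter (fun b => φ b = m)) := by
          rw [← Finset.mul_sum, Finset.sum_comm]
          simp only [kgN_char]
      _ ≤ (M.card : ℝ) ^ (2 * r - 1) * ∑ m ∈ M, (q : ℝ) * T := by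
          gcongr with m hm
          exact hT m hm
      _ = (q : ℝ) * (((M.card : ℝ) ^ (2 * r - 1) * M.card) * T) := by
          rw [Finset.sum_const, nsmul_eq_mul]; ring
      _ = _ := by
          rw [← pow_succ, show 2 * r - 1 + 1 = 2 * r by omega]
  exact le_of_mul_le_mul_left h3 hq

open scoped Classical in
lemma kg_split (r q V W : ℕ) (hr : 1 ≤ r) (hq : 0 < q) (lam : ℤ) (hW : 1 ≤ W) (hWV : W ≤ V) (T : ℝ)
    (hT : ∀ m : ℤ, (Kcount r q m W : ℝ) ≤ T) :
    (Kcount r q lam V : ℝ) ≤ (4 * V / W : ℝ) ^ (2 * r) * T := by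
  have hW0 : (0 : ℤ) < W := by exact_mod_cast hW
  set x : ℤ → ZMod q := fun b => (((lam + b : ℤ) : ZMod q))⁻¹ with hx
  set B := (Finset.Icc (-(V : ℤ)) (V : ℤ)).filter (fun b => IsUnit ((lam + b : ℤ) : ZMod q)) with hB
  set M := Finset.Icc ((-(V : ℤ)) / W) ((V : ℤ) / W) with hM
  have h0 : Kcount r q lam V ≤ kgN r q x B := by
    unfold Kcount kgN
    apply Finset.card_le_card
    intro v hv
    have hv := Finset.mem_filter.mp hv
    have hv1 := Fintype.mem_piFinset.mp hv.1
    refine Finset.mem_filter.mpr ⟨Fintype.mem_piFinset.mpr ?_, hv.2.2⟩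
    exact fun i => Finset.mem_filter.mpr ⟨hv1 i, hv.2.1 i⟩
  have hpiece : ∀ m : ℤ, kgN r q x (B.filter (fun b => b / (W : ℤ) = m)) ≤ Kcount r q (lam + m * W) W := by
      intro m
      unfold Kcount kgN
      apply Finset.card_le_card_of_injOn (fun v i => v i - m * W)
      · intro v hv
        have hv := Finset.mem_filter.mp (Finset.mem_coe.mp hv)
        have hv1 := Fintype.mem_piFinset.mp hv.1
        have hsh : ∀ i, lam + m * W + (v i - m * W) = lam + v i := fun i => by ring
        refine Finset.mem_coe.mpr (Finset.mem_filter.mpr ⟨Fintype.mem_piFinset.mpr ?_, ?_, ?_⟩)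
        · intro i
          have h2 := (Finset.mem_filter.mp (hv1 i)).2
          have h3 := Int.emod_add_mul_ediv (v i) W
          have h4 := Int.emod_nonneg (v i) hW0.ne'
          have h5 := Int.emod_lt_of_pos (v i) hW0
          rw [h2, mul_comm] at h3
          rw [Finset.mem_Icc]
          constructor <;> linarith
        · intro i
          have h2 := (Finset.mem_filter.mp (Finset.mem_filter.mp (hv1 i)).1).2
          rw [hsh]
          exact h2
        · have h2 := hv.2
          simp only [hx] at h2
          simp only [hsh]
          exact h2
      · intro v _ w _ hvw
        funext i
        have := congrFun hvw i
        simpa using this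
  have hBI : ∀ b ∈ B, b ∈ Finset.Icc (-(V : ℤ)) (V : ℤ) := fun b hb => (Finset.mem_filter.mp hb).1
  have : NeZero q := ⟨hq.ne'⟩
  have hT0 : 0 ≤ T := le_trans (by positivity) (hT 0)
  have h1 := kgN_holder r q hr x B M (fun b => b / W) (by
    intro b hb
    have := Finset.mem_Icc.mp (hBI b hb)
    exact Finset.mem_Icc.mpr ⟨Int.ediv_le_ediv hW0 this.1, Int.ediv_le_ediv hW0 this.2⟩) T (by
    intro m _
    refine le_trans ?_ (hT (lam + m * W))
    exact_mod_cast hpiece m)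
  have hMc : (M.card : ℝ) ≤ 4 * V / W := by
    have hWr : (0 : ℝ) < W := by exact_mod_cast hW
    rw [le_div_iff₀ hWr]
    have h2 : (M.card : ℤ) * W ≤ 4 * V := by
      have h3 : (M.card : ℤ) = (V : ℤ) / W + 1 - (-(V : ℤ)) / W := by
        rw [hM, Int.card_Icc, Int.toNat_of_nonneg]
        have : (-(V : ℤ)) / W ≤ (V : ℤ) / W := Int.ediv_le_ediv hW0 (by omega)
        omega
      rw [h3]
      have h4 := Int.mul_ediv_self_le (x := (V : ℤ)) (k := (W : ℤ)) hW0.ne'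
      have h5 := Int.lt_mul_ediv_self_add (x := -(V : ℤ)) (k := (W : ℤ)) hW0
      have h6 : (W : ℤ) ≤ V := by exact_mod_cast hWV
      nlinarith
    exact_mod_cast h2
  have h0' : (Kcount r q lam V : ℝ) ≤ kgN r q x B := by exact_mod_cast h0
  refine h0'.trans (h1.trans ?_)
  gcongr


lemma kg_trivial (r q V : ℕ) (lam : ℤ) (hV : 1 ≤ V) : (Kcount r q lam V : ℝ) ≤ (3 * V : ℝ) ^ (2 * r) := by
  have h : Kcount r q lam V ≤ (3 * V) ^ (2 * r) := by
    classical
    unfold Kcount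
    refine (Finset.card_le_card (Finset.filter_subset _ _)).trans ?_
    rw [Fintype.card_piFinset]
    simp only [Int.card_Icc, Finset.prod_const, Finset.card_univ, Fintype.card_fin]
    rw [← two_mul]
    exact Nat.pow_le_pow_left (by omega) _
  exact_mod_cast h

/-- Unrestricted Kloosterman-fraction bound:
`K_{r,q}(λ, V) ≤ C(r,ε)·(V^{2r}/q^{1/(4(r-1))} + V^r)·q^ε`. -/
theorem Kcount_general (r : ℕ) (hr : 2 ≤ r) :
    ∀ ε : ℝ, 0 < ε → ∃ Cst : ℝ, 0 < Cst ∧ ∀ q : ℕ, 0 < q → ∀ lam : ℤ, ∀ V : ℕ, 1 ≤ V →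
      (Kcount r q lam V : ℝ) ≤
        Cst * ((V : ℝ) ^ (2 * r) / (q : ℝ) ^ ((1 : ℝ) / (4 * (r - 1))) + (V : ℝ) ^ (r : ℕ)) *
          (q : ℝ) ^ ε := by
  intro ε hε
  obtain ⟨K, hK0, hK⟩ := kg_restricted r hr ε hε
  set α : ℝ := (1 : ℝ) / (4 * (r - 1)) with hα
  have hr1 : (0 : ℝ) < (r : ℝ) - 1 := by
    have : (2 : ℝ) ≤ r := by exact_mod_cast hr
    linarith
  have hα0 : 0 < α := by positivity
  set N : ℕ := 4 * r * (r - 1) with hN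
  have hNα : (N : ℝ) * α = r := by
    rw [hN, hα]
    push_cast [Nat.cast_sub (by omega : 1 ≤ r)]
    field_simp
  have hC1 : 1 ≤ kgC1 r := Nat.mul_pos (Nat.factorial_pos _) (pow_pos (kgK1_pos hr) _)
  set A : ℝ := ((kgC1 r : ℝ) * 2 ^ N) ^ α with hA
  have hA0 : 0 ≤ A := by positivity
  set Cst : ℝ := 3 ^ (2 * r) * (kgC1 r : ℝ) ^ α + K + 4 ^ (2 * r) * K * A + 1 with hCst
  have hCa : 0 ≤ (3 : ℝ) ^ (2 * r) * (kgC1 r : ℝ) ^ α := by positivity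
  have hCb : 0 ≤ (4 : ℝ) ^ (2 * r) * K * A := by positivity
  have hC0 : 0 < Cst := by linarith
  refine ⟨Cst, hC0, ?_⟩
  intro q hq lam V hV
  have hVr : (1 : ℝ) ≤ V := by exact_mod_cast hV
  have hqr : (1 : ℝ) ≤ q := by exact_mod_cast hq
  have hqε : (1 : ℝ) ≤ (q : ℝ) ^ ε := Real.one_le_rpow hqr hε.le
  have hqα : (0 : ℝ) < (q : ℝ) ^ α := by positivity
  have hX : 0 ≤ (V : ℝ) ^ (2 * r) / (q : ℝ) ^ α := by positivity
  have hY : 0 ≤ (V : ℝ) ^ r := by positivity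
  rcases le_or_gt q (kgC1 r) with hqC | hqC
  · have h1 : (q : ℝ) ^ α ≤ (kgC1 r : ℝ) ^ α :=
      Real.rpow_le_rpow (by positivity) (by exact_mod_cast hqC) hα0.le
    calc (Kcount r q lam V : ℝ) ≤ (3 * V : ℝ) ^ (2 * r) := kg_trivial r q V lam hV
      _ = 3 ^ (2 * r) * (q : ℝ) ^ α * ((V : ℝ) ^ (2 * r) / (q : ℝ) ^ α) := by
          rw [mul_pow]; field_simp
      _ ≤ 3 ^ (2 * r) * (kgC1 r : ℝ) ^ α * ((V : ℝ) ^ (2 * r) / (q : ℝ) ^ α) := by gcongr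
      _ ≤ Cst * ((V : ℝ) ^ (2 * r) / (q : ℝ) ^ α + (V : ℝ) ^ r) :=
          mul_le_mul (by linarith) (by linarith) hX hC0.le
      _ ≤ _ := le_mul_of_one_le_right (by positivity) hqε
  rcases lt_or_ge (kgC1 r * V ^ N) q with hVq | hVq
  · calc (Kcount r q lam V : ℝ) ≤ K * (q : ℝ) ^ ε * (V : ℝ) ^ r := hK q V lam hV hVq
      _ = (K * (V : ℝ) ^ r) * (q : ℝ) ^ ε := by ring
      _ ≤ (Cst * ((V : ℝ) ^ (2 * r) / (q : ℝ) ^ α + (V : ℝ) ^ r)) * (q : ℝ) ^ ε := by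
          apply mul_le_mul_of_nonneg_right _ (by linarith)
          exact mul_le_mul (by linarith) (by linarith) hY hC0.le
  have hex : ∃ n, q ≤ kgC1 r * n ^ N := ⟨V, hVq⟩
  have hNpos : N ≠ 0 := by
    rw [hN]
    have : 0 < r - 1 := by omega
    positivity
  obtain ⟨W, hWn⟩ : ∃ W, Nat.find hex = W + 1 := by
    refine Nat.exists_eq_succ_of_ne_zero ?_
    intro h0
    have := Nat.find_spec hex
    rw [h0, zero_pow hNpos] at this
    omega
  have hWq : kgC1 r * W ^ N < q := not_le.mp (Nat.find_min hex (by omega))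
  have hqW : q ≤ kgC1 r * (W + 1) ^ N := hWn ▸ Nat.find_spec hex
  have hW1 : 1 ≤ W := by
    rcases Nat.eq_zero_or_pos W with h | h
    · rw [h] at hqW
      simp at hqW
      omega
    · exact h
  have hWV : W ≤ V := by
    have := Nat.find_min' hex hVq
    omega
  have hWr : (0 : ℝ) < W := by exact_mod_cast hW1
  have h1 := kg_split r q V W (by omega) hq lam hW1 hWV (K * (q : ℝ) ^ ε * (W : ℝ) ^ r)
    (fun m => hK q W m hW1 hWq)
  have h2 : (q : ℝ) ^ α ≤ A * (W : ℝ) ^ r := by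
    have h3 : q ≤ (kgC1 r * 2 ^ N) * W ^ N := by
      refine hqW.trans ?_
      rw [mul_assoc, ← mul_pow]
      exact Nat.mul_le_mul_left _ (Nat.pow_le_pow_left (by omega) _)
    have h4 : (q : ℝ) ≤ ((kgC1 r : ℝ) * 2 ^ N) * (W : ℝ) ^ N := by exact_mod_cast h3
    calc (q : ℝ) ^ α ≤ (((kgC1 r : ℝ) * 2 ^ N) * (W : ℝ) ^ N) ^ α :=
          Real.rpow_le_rpow (by positivity) h4 hα0.le
      _ = A * (W : ℝ) ^ r := by
          rw [Real.mul_rpow (by positivity) (by positivity), ← hA, ← Real.rpow_natCast (W : ℝ) N,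
            ← Real.rpow_mul hWr.le, hNα, Real.rpow_natCast]
  calc (Kcount r q lam V : ℝ) ≤ (4 * V / W : ℝ) ^ (2 * r) * (K * (q : ℝ) ^ ε * (W : ℝ) ^ r) := h1
    _ = (4 ^ (2 * r) * K * ((V : ℝ) ^ (2 * r) * (1 / (W : ℝ) ^ r))) * (q : ℝ) ^ ε := by
        rw [div_pow, mul_pow, two_mul r, pow_add (W : ℝ)]
        field_simp
    _ ≤ (4 ^ (2 * r) * K * ((V : ℝ) ^ (2 * r) * (A / (q : ℝ) ^ α))) * (q : ℝ) ^ ε := by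
        have h5 : 1 / (W : ℝ) ^ r ≤ A / (q : ℝ) ^ α := by
          rw [div_le_div_iff₀ (by positivity) hqα, one_mul]
          exact h2
        gcongr
    _ = (4 ^ (2 * r) * K * A * ((V : ℝ) ^ (2 * r) / (q : ℝ) ^ α)) * (q : ℝ) ^ ε := by ring
    _ ≤ (Cst * ((V : ℝ) ^ (2 * r) / (q : ℝ) ^ α + (V : ℝ) ^ r)) * (q : ℝ) ^ ε := by
        apply mul_le_mul_of_nonneg_right _ (by linarith)
        exact mul_le_mul (by linarith) (by linarith) hX hC0.le
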